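/- arXiv:0704.3825 — 4 statements merged into one kernel-verified Lean document; each statement's English description precedes it below -/
import Mathlib

section
/- Let α, β : ℝ → ℍ be complete geodesics in the hyperbolic plane whose images are distinct (Set.range α ≠ Set.range β) but intersect (Set.range α ∩ Set.range β ≠ ∅), i.e. α and β cross transversely. Then for every c > 0 the set {t ∈ ℝ | dist(α(t), Set.range β) ≤ c} is bounded. -/
open UpperHalfPlane

/-- Hyperboloid coordinates of `z` based at `p`. -/
noncomputable def hypU (p z : UpperHalfPlane) : ℝ :=
  ((z.re - p.re) ^ 2 + z.im ^ 2 + p.im ^ 2) / (2 * z.im * p.im)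

noncomputable def hypV (p z : UpperHalfPlane) : ℝ := (z.re - p.re) / z.im

noncomputable def hypW (p z : UpperHalfPlane) : ℝ :=
  ((z.re - p.re) ^ 2 + z.im ^ 2 - p.im ^ 2) / (2 * z.im * p.im)

lemma hypU_eq (p z : UpperHalfPlane) : hypU p z = Real.cosh (dist z p) := by
  rw [cosh_dist']; rfl

lemma hyp_sq (p z : UpperHalfPlane) : hypU p z ^ 2 = 1 + hypV p z ^ 2 + hypW p z ^ 2 := by
  have h1 := z.im_pos
  have h2 := p.im_pos
  unfold hypU hypV hypW
  field_simp
  ring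

lemma hyp_dist (p z w : UpperHalfPlane) : Real.cosh (dist z w) =
    hypU p z * hypU p w - hypV p z * hypV p w - hypW p z * hypW p w := by
  have h1 := z.im_pos
  have h2 := p.im_pos
  have h3 := w.im_pos
  rw [cosh_dist']
  unfold hypU hypV hypW
  field_simp
  ring

lemma hyp_inj (p z w : UpperHalfPlane) (hv : hypV p z = hypV p w) (hw : hypW p z = hypW p w) :
    z = w := by
  have hu : hypU p z = hypU p w := by
    have := hyp_sq p z
    have h2 := hyp_sq p w
    rw [hv, hw, ← h2] at this
    have a1 : 0 ≤ hypU p z := by rw [hypU_eq]; positivity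
    have a2 : 0 ≤ hypU p w := by rw [hypU_eq]; positivity
    exact (sq_eq_sq₀ a1 a2).1 this
  have h := hyp_dist p z w
  rw [hv, hw, hu] at h
  have h2 := hyp_sq p w
  have h3 : Real.cosh (dist z w) = 1 := by rw [h]; linarith
  by_contra hne
  have := Real.one_lt_cosh.2 (dist_pos.2 hne).ne'
  linarith

lemma hyp_geod (γ : ℝ → UpperHalfPlane) (h : ∀ s t : ℝ, dist (γ s) (γ t) = |s - t|) (a : ℝ) :
    ∃ e f : ℝ, e ^ 2 + f ^ 2 = 1 ∧ ∀ t, hypU (γ a) (γ (a + t)) = Real.cosh t ∧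
      hypV (γ a) (γ (a + t)) = Real.sinh t * e ∧ hypW (γ a) (γ (a + t)) = Real.sinh t * f := by
  have hU : ∀ t, hypU (γ a) (γ (a + t)) = Real.cosh t := by
    intro t
    rw [hypU_eq, h, Real.cosh_abs]; congr 1; ring
  have hS : ∀ t, hypV (γ a) (γ (a + t)) ^ 2 + hypW (γ a) (γ (a + t)) ^ 2 = Real.sinh t ^ 2 := by
    intro t
    have := hyp_sq (γ a) (γ (a + t))
    rw [hU, Real.cosh_sq] at this
    linarith
  have hP : ∀ t s, hypV (γ a) (γ (a + t)) * hypV (γ a) (γ (a + s)) +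
      hypW (γ a) (γ (a + t)) * hypW (γ a) (γ (a + s)) = Real.sinh t * Real.sinh s := by
    intro t s
    have := hyp_dist (γ a) (γ (a + t)) (γ (a + s))
    rw [hU, hU, h, Real.cosh_abs, show a + t - (a + s) = t - s by ring, Real.cosh_sub] at this
    linarith
  have hpos : 0 < Real.sinh 1 := Real.sinh_pos_iff.2 one_pos
  obtain ⟨e, he⟩ : ∃ e, hypV (γ a) (γ (a + 1)) = Real.sinh 1 * e :=
    ⟨hypV (γ a) (γ (a + 1)) / Real.sinh 1, by field_simp⟩
  obtain ⟨f, hf⟩ : ∃ f, hypW (γ a) (γ (a + 1)) = Real.sinh 1 * f :=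
    ⟨hypW (γ a) (γ (a + 1)) / Real.sinh 1, by field_simp⟩
  have hef : e ^ 2 + f ^ 2 = 1 := by
    have := hS 1
    rw [he, hf] at this
    have h2 : Real.sinh 1 ^ 2 * (e ^ 2 + f ^ 2) = Real.sinh 1 ^ 2 * 1 := by linarith
    exact mul_left_cancel₀ (by positivity) h2
  refine ⟨e, f, hef, fun t => ⟨hU t, ?_⟩⟩
  have h1 := hS t
  have h2 := hP t 1
  rw [he, hf] at h2
  have h3 : hypV (γ a) (γ (a + t)) * e + hypW (γ a) (γ (a + t)) * f = Real.sinh t := by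
    apply mul_left_cancel₀ hpos.ne'
    linarith
  generalize hypV (γ a) (γ (a + t)) = v at *
  generalize hypW (γ a) (γ (a + t)) = w at *
  generalize Real.sinh t = s at *
  have h4 : (v - s * e) ^ 2 + (w - s * f) ^ 2 = 0 := by
    linear_combination h1 - 2 * s * h3 + s ^ 2 * hef
  constructor
  · have : (v - s * e) ^ 2 = 0 := by nlinarith [sq_nonneg (v - s * e), sq_nonneg (w - s * f)]
    have := pow_eq_zero_iff (two_ne_zero) |>.1 this
    linarith
  · have : (w - s * f) ^ 2 = 0 := by nlinarith [sq_nonneg (v - s * e), sq_nonneg (w - s * f)]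
    have := pow_eq_zero_iff (two_ne_zero) |>.1 this
    linarith

theorem transverse_geodesics_close_on_bounded_set
    (α β : ℝ → UpperHalfPlane)
    (hα : ∀ s t : ℝ, dist (α s) (α t) = |s - t|)
    (hβ : ∀ s t : ℝ, dist (β s) (β t) = |s - t|)
    (hne : Set.range α ≠ Set.range β)
    (hint : (Set.range α ∩ Set.range β).Nonempty) :
    ∀ c : ℝ, 0 < c →
      Bornology.IsBounded {t : ℝ | Metric.infDist (α t) (Set.range β) ≤ c} := by
  intro c hc
  obtain ⟨p, ⟨a, ha⟩, ⟨b, hb⟩⟩ := hint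
  obtain ⟨e, f, hef, hA⟩ := hyp_geod α hα a
  obtain ⟨e', f', hef', hB⟩ := hyp_geod β hβ b
  rw [ha] at hA
  rw [hb] at hB
  have key : |e * e' + f * f'| < 1 := by
    by_contra hk
    apply hne
    have hid : (e * e' + f * f') ^ 2 + (e * f' - f * e') ^ 2 = 1 := by
      linear_combination hef * (e' ^ 2 + f' ^ 2) + hef'
    have hk2 : 1 ≤ (e * e' + f * f') ^ 2 := by
      rw [← sq_abs]; nlinarith
    have hk3 : (e * e' + f * f') ^ 2 = 1 := by nlinarith [sq_nonneg (e * f' - f * e')]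
    have hcr : e * f' - f * e' = 0 := by
      apply pow_eq_zero_iff (two_ne_zero) |>.1; linarith
    obtain ⟨k, hk⟩ : ∃ k, k = e * e' + f * f' := ⟨_, rfl⟩
    have he : e' = k * e := by rw [hk]; linear_combination -e' * hef - f * hcr
    have hf : f' = k * f := by rw [hk]; linear_combination -f' * hef + e * hcr
    rw [← hk] at hk3
    have hk1 : k = 1 ∨ k = -1 := by simpa using hk3
    rcases hk1 with rfl | rfl
    · have : ∀ t, α (a + t) = β (b + t) := fun t => by
        apply hyp_inj p
        · rw [(hA t).2.1, (hB t).2.1, he]; ring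
        · rw [(hA t).2.2, (hB t).2.2, hf]; ring
      ext z; constructor
      · rintro ⟨t, rfl⟩
        exact ⟨b + (t - a), by rw [← this]; congr 1; ring⟩
      · rintro ⟨t, rfl⟩
        exact ⟨a + (t - b), by rw [this]; congr 1; ring⟩
    · have : ∀ t, α (a + t) = β (b + -t) := fun t => by
        apply hyp_inj p
        · rw [(hA t).2.1, (hB (-t)).2.1, he, Real.sinh_neg]; ring
        · rw [(hA t).2.2, (hB (-t)).2.2, hf, Real.sinh_neg]; ring
      ext z; constructor
      · rintro ⟨t, rfl⟩
        exact ⟨b + -(t - a), by rw [← this]; congr 1; ring⟩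
      · rintro ⟨t, rfl⟩
        exact ⟨a + (b - t), by rw [this]; congr 1; ring⟩
  rw [isBounded_iff_forall_norm_le]
  refine ⟨|a| + Real.cosh (c + 1) / (1 - |e * e' + f * f'|), fun t ht => ?_⟩
  have ht' : Metric.infDist (α t) (Set.range β) < c + 1 := lt_of_le_of_lt ht (by linarith)
  obtain ⟨_, ⟨s, rfl⟩, hs⟩ := (Metric.infDist_lt_iff (Set.range_nonempty β)).1 ht'
  obtain ⟨x, rfl⟩ : ∃ x, t = a + x := ⟨t - a, by ring⟩
  obtain ⟨y, rfl⟩ : ∃ y, s = b + y := ⟨s - b, by ring⟩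
  have h1 : Real.cosh (dist (α (a + x)) (β (b + y))) ≤ Real.cosh (c + 1) := by
    rw [Real.cosh_le_cosh, abs_of_nonneg dist_nonneg, abs_of_pos (by linarith)]
    exact hs.le
  rw [hyp_dist p, (hA x).1, (hA x).2.1, (hA x).2.2, (hB y).1, (hB y).2.1, (hB y).2.2] at h1
  set k := e * e' + f * f' with hk
  have habs : ∀ r, |Real.sinh r| ≤ Real.cosh r := fun r =>
    abs_le_of_sq_le_sq (by rw [Real.cosh_sq]; linarith) (Real.cosh_pos r).le
  have h2 : k * (Real.sinh x * Real.sinh y) ≤ |k| * (Real.cosh x * Real.cosh y) := by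
    refine (le_abs_self _).trans ?_
    rw [abs_mul, abs_mul]
    gcongr
    · exact habs x
    · exact habs y
  have h3 : (1 - |k|) * (Real.cosh x * 1) ≤ (1 - |k|) * (Real.cosh x * Real.cosh y) := by
    have := Real.one_le_cosh y
    gcongr
  have h4 : Real.cosh x ≤ Real.cosh (c + 1) / (1 - |k|) := by
    rw [le_div_iff₀ (by linarith)]
    rw [hk] at h2 h3 ⊢
    linarith
  have h5 : |x| ≤ Real.cosh x := by
    refine le_trans ?_ (habs x)
    rw [Real.abs_sinh]
    exact Real.self_le_sinh_iff.2 (abs_nonneg x)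
  rw [Real.norm_eq_abs]
  linarith [abs_add_le a x]
end

section
/- Let ε > 0 and let α, β : ℝ → ℍ be complete geodesics in the hyperbolic plane that cross transversely (Set.range α ≠ Set.range β and Set.range α ∩ Set.range β ≠ ∅). Let I = {t | dist(α(t), Set.range β) ≤ 2ε} and J = {t | dist(β(t), Set.range α) ≤ 2ε}. Suppose α′, β′ : ℝ → ℍ are complete geodesics such that dist(α′(t), α(t)) ≤ ε for all t ∈ I and dist(β′(t), β(t)) ≤ ε for all t ∈ J. Then α′ and β′ intersect: there exist s, t ∈ ℝ with α′(s) = β′(t), and moreover such an intersection point can be found at distance at most ε from the set α(I) = {α(u) | u ∈ I}. -/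
open UpperHalfPlane

/-- Lorentzian form on `ℝ³`. -/
noncomputable def tfB (x y : ℝ × ℝ × ℝ) : ℝ := (x.1 * y.2.2 + x.2.2 * y.1) / 2 - x.2.1 * y.2.1

/-- Embedding of the upper half plane in the hyperboloid. -/
noncomputable def tfX (z : UpperHalfPlane) : ℝ × ℝ × ℝ :=
  (1 / z.im, z.re / z.im, (z.re ^ 2 + z.im ^ 2) / z.im)

lemma tfB_comm (x y) : tfB x y = tfB y x := by simp only [tfB]; ring
lemma tfB_add_right (x y z) : tfB x (y + z) = tfB x y + tfB x z := by
  simp only [tfB, Prod.fst_add, Prod.snd_add]; ring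
lemma tfB_sub_right (x y z) : tfB x (y - z) = tfB x y - tfB x z := by
  simp only [tfB, Prod.fst_sub, Prod.snd_sub]; ring
lemma tfB_smul_right (c : ℝ) (x y) : tfB x (c • y) = c * tfB x y := by
  simp only [tfB, Prod.smul_fst, Prod.smul_snd, smul_eq_mul]; ring
lemma tfB_add_left (x y z) : tfB (y + z) x = tfB y x + tfB z x := by
  simp only [tfB, Prod.fst_add, Prod.snd_add]; ring
lemma tfB_sub_left (x y z) : tfB (y - z) x = tfB y x - tfB z x := by
  simp only [tfB, Prod.fst_sub, Prod.snd_sub]; ring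
lemma tfB_smul_left (c : ℝ) (x y) : tfB (c • y) x = c * tfB y x := by
  simp only [tfB, Prod.smul_fst, Prod.smul_snd, smul_eq_mul]; ring

lemma tfX_self (z) : tfB (tfX z) (tfX z) = 1 := by
  have := z.im_ne_zero
  simp only [tfB, tfX]; field_simp; ring

lemma tfX_dist (z w) : tfB (tfX z) (tfX w) = Real.cosh (dist z w) := by
  have h1 := z.im_ne_zero
  have h2 := w.im_ne_zero
  rw [UpperHalfPlane.cosh_dist']
  simp only [tfB, tfX]; field_simp; ring

lemma tfX_inj {z w : UpperHalfPlane} {r s : ℝ} (hr : 0 < r) (hs : 0 < s)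
    (h : r • tfX z = s • tfX w) : z = w := by
  have h1 := z.im_pos
  have h2 := w.im_pos
  have e0 : r * s * tfB (tfX z) (tfX w) = r * r := by
    have : tfB (r • tfX z) (r • tfX z) = tfB (r • tfX z) (s • tfX w) := by rw [← h]
    simp only [tfB_smul_left, tfB_smul_right, tfX_self] at this
    linarith
  have e1 : r * s * tfB (tfX z) (tfX w) = s * s := by
    have : tfB (s • tfX w) (s • tfX w) = tfB (r • tfX z) (s • tfX w) := by rw [← h]
    simp only [tfB_smul_left, tfB_smul_right, tfX_self] at this
    linarith
  have hrs : r = s := by nlinarith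
  subst hrs
  have hc : Real.cosh (dist z w) = 1 := by
    rw [← tfX_dist]
    have : r * r ≠ 0 := by positivity
    apply mul_left_cancel₀ this; linarith
  by_contra hne
  have := Real.one_lt_cosh.2 (dist_pos.2 hne).ne'
  linarith

/-- Gram inequality. -/
lemma tf_gram (x y z) : 0 ≤ tfB x x * (tfB y y * tfB z z - tfB y z ^ 2)
    - tfB x y * (tfB x y * tfB z z - tfB y z * tfB x z)
    + tfB x z * (tfB x y * tfB y z - tfB y y * tfB x z) := by
  obtain ⟨x1, x2, x3⟩ := x
  obtain ⟨y1, y2, y3⟩ := y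
  obtain ⟨z1, z2, z3⟩ := z
  have := sq_nonneg (x1 * (y2 * z3 - y3 * z2) - x2 * (y1 * z3 - y3 * z1) + x3 * (y1 * z2 - y2 * z1))
  simp only [tfB]
  refine le_of_le_of_eq (div_nonneg this (by norm_num : (0:ℝ) ≤ 4)) ?_
  ring

/-- Vanishing of the 4 by 4 Gram determinant, special case. -/
lemma tf_gram4 (n p v w : ℝ × ℝ × ℝ) (hp : tfB p p = 1) (hpv : tfB p v = 0) (hpw : tfB p w = 0)
    (hv : tfB v v = -1) (hw : tfB w w = -1) :
    (tfB n p ^ 2 - tfB n n) * (1 - tfB v w ^ 2) =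
      tfB n v ^ 2 + tfB n w ^ 2 + 2 * tfB v w * tfB n v * tfB n w := by
  have key : ∀ m v w p : ℝ × ℝ × ℝ, tfB p m = 0 → tfB p v = 0 → tfB p w = 0 → tfB p p = 1 →
      tfB m m * (tfB v v * tfB w w - tfB v w ^ 2)
    - tfB m v * (tfB m v * tfB w w - tfB v w * tfB m w)
    + tfB m w * (tfB m v * tfB v w - tfB v v * tfB m w) = 0 := by
    rintro ⟨x1, x2, x3⟩ ⟨y1, y2, y3⟩ ⟨z1, z2, z3⟩ ⟨p1, p2, p3⟩ h1 h2 h3 h4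
    simp only [tfB] at *
    set D := (x1 * (y2 * z3 - y3 * z2) - x2 * (y1 * z3 - y3 * z1) + x3 * (y1 * z2 - y2 * z1)) with hD
    have d1 : p1 * D = 0 := by
      rw [hD]
      linear_combination (2 * (y1 * z2 - y2 * z1)) * h1 - (2 * (x1 * z2 - x2 * z1)) * h2 + (2 * (x1 * y2 - x2 * y1)) * h3
    have d3 : p3 * D = 0 := by
      rw [hD]
      linear_combination (2 * (y2 * z3 - y3 * z2)) * h1 - (2 * (x2 * z3 - x3 * z2)) * h2 + (2 * (x2 * y3 - x3 * y2)) * h3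
    have d2 : p2 * D = 0 := by
      rw [hD]
      linear_combination (y1 * z3 - y3 * z1) * h1 - (x1 * z3 - x3 * z1) * h2 + (x1 * y3 - x3 * y1) * h3
    have d0 : D = 0 := by
      linear_combination (-D) * h4 + p3 * d1 - p2 * d2
    have : D ^ 2 / 4 = 0 := by rw [d0]; norm_num
    rw [← this, hD]; ring
  have := key (n - tfB n p • p) v w p (by rw [tfB_sub_right, tfB_smul_right, hp, tfB_comm p n]; ring)
    hpv hpw hp
  simp only [tfB_sub_left, tfB_sub_right, tfB_smul_left, tfB_smul_right, hp, hpv, hpw, hv, hw, tfB_comm p n] at this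
  linarith

lemma tf_null (p w : ℝ × ℝ × ℝ) (hp : tfB p p = 1) (hpw : tfB p w = 0) (hw : tfB w w = 0) : w = 0 := by
  obtain ⟨p1, p2, p3⟩ := p
  obtain ⟨w1, w2, w3⟩ := w
  simp only [tfB] at *
  have hp1 : p1 ≠ 0 := by
    rintro rfl
    nlinarith [sq_nonneg p2]
  have e : (p1 * w2 - p2 * w1) ^ 2 + w1 ^ 2 = 0 := by
    linear_combination (- w1 ^ 2) * hp + 2 * p1 * w1 * hpw - p1 ^ 2 * hw
  have h1 : w1 = 0 := by nlinarith [sq_nonneg (p1 * w2 - p2 * w1), sq_nonneg w1]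
  subst h1
  have h2 : w2 = 0 := by
    have : p1 * w2 = 0 := by nlinarith [sq_nonneg (p1 * w2)]
    simpa [hp1] using this
  subst h2
  have h3 : w3 = 0 := by
    have : p1 * w3 = 0 := by linarith
    simpa [hp1] using this
  subst h3
  rfl

lemma tf_geod (γ : ℝ → UpperHalfPlane) (h : ∀ s t : ℝ, dist (γ s) (γ t) = |s - t|) (a : ℝ) :
    ∃ v, tfB (tfX (γ a)) v = 0 ∧ tfB v v = -1 ∧
      ∀ t, tfX (γ (a + t)) = Real.cosh t • tfX (γ a) + Real.sinh t • v := by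
  have hs : Real.sinh 1 ≠ 0 := (Real.sinh_pos_iff.2 one_pos).ne'
  have hB : ∀ s t, tfB (tfX (γ (a + s))) (tfX (γ (a + t))) = Real.cosh (s - t) := by
    intro s t
    rw [tfX_dist, h, Real.cosh_abs]; congr 1; ring
  have hP : tfB (tfX (γ a)) (tfX (γ a)) = 1 := tfX_self _
  have hP1 : tfB (tfX (γ a)) (tfX (γ (a+1))) = Real.cosh 1 := by
    have := hB 0 1; simpa using this
  have h11 : tfB (tfX (γ (a+1))) (tfX (γ (a+1))) = 1 := tfX_self _
  have hc := Real.cosh_sq 1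
  have hPv : tfB (tfX (γ a)) ((Real.sinh 1)⁻¹ • (tfX (γ (a+1)) - Real.cosh 1 • tfX (γ a))) = 0 := by
    simp only [tfB_sub_right, tfB_smul_right, hP, hP1]; ring
  have hvv : tfB ((Real.sinh 1)⁻¹ • (tfX (γ (a+1)) - Real.cosh 1 • tfX (γ a))) ((Real.sinh 1)⁻¹ • (tfX (γ (a+1)) - Real.cosh 1 • tfX (γ a))) = -1 := by
    simp only [tfB_sub_right, tfB_smul_right, tfB_sub_left, tfB_smul_left, hP, hP1, h11, tfB_comm (tfX (γ (a+1))) (tfX (γ a))]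
    field_simp; linarith
  have htv : ∀ t, tfB (tfX (γ (a+t))) ((Real.sinh 1)⁻¹ • (tfX (γ (a+1)) - Real.cosh 1 • tfX (γ a))) = - Real.sinh t := by
    intro t
    have h0 := hB t 0
    rw [add_zero, sub_zero] at h0
    simp only [tfB_sub_right, tfB_smul_right, h0, hB t 1, Real.cosh_sub]
    field_simp; ring
  refine ⟨_, hPv, hvv, ?_⟩
  generalize (Real.sinh 1)⁻¹ • (tfX (γ (a+1)) - Real.cosh 1 • tfX (γ a)) = v at *
  intro t
  have h0 := hB t 0
  rw [add_zero, sub_zero] at h0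
  have hct := Real.cosh_sq t
  have hself : tfB (tfX (γ (a+t))) (tfX (γ (a+t))) = 1 := tfX_self _
  have hvt := htv t
  rw [tfB_comm] at hvt
  have h0' := h0
  rw [tfB_comm] at h0'
  have hPv' := hPv
  rw [tfB_comm] at hPv'
  refine sub_eq_zero.1 (tf_null (tfX (γ (a + t))) _ hself ?_ ?_)
  · simp only [tfB_sub_right, tfB_add_right, tfB_smul_right, hself, h0, htv]
    linarith
  · simp only [tfB_sub_right, tfB_add_right, tfB_smul_right, tfB_sub_left, tfB_add_left, tfB_smul_left, hself, h0, htv, hvt, h0', hP, hPv, hPv', hvv]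
    linarith

lemma tf_seg (γ : ℝ → UpperHalfPlane) (h : ∀ s t : ℝ, dist (γ s) (γ t) = |s - t|) (a T : ℝ) (hT : 0 < T)
    (l m : ℝ) (hl : 0 ≤ l) (hm : 0 ≤ m) (hlm : 0 < l + m) :
    ∃ t, |t| ≤ T ∧ ∃ r : ℝ, 0 < r ∧ l • tfX (γ (a + T)) + m • tfX (γ (a - T)) = r • tfX (γ (a + t)) := by
  obtain ⟨v, -, -, hv⟩ := tf_geod γ h a
  have hS := Real.sinh_pos_iff.2 hT
  have hC := Real.cosh_pos T
  have hCS := Real.cosh_sq T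
  set C := Real.cosh T
  set S := Real.sinh T
  have hpos : 0 < (l + m) ^ 2 * C ^ 2 - (l - m) ^ 2 * S ^ 2 := by
    rw [hCS]; nlinarith [mul_nonneg (mul_nonneg hl hm) (sq_nonneg S), pow_pos hlm 2]
  set r := Real.sqrt ((l + m) ^ 2 * C ^ 2 - (l - m) ^ 2 * S ^ 2) with hr
  have hr0 : 0 < r := Real.sqrt_pos.2 hpos
  have hr2 : r ^ 2 = (l + m) ^ 2 * C ^ 2 - (l - m) ^ 2 * S ^ 2 := Real.sq_sqrt hpos.le
  have hsinh : Real.sinh (Real.arsinh ((l - m) * S / r)) = (l - m) * S / r := Real.sinh_arsinh _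
  have hcosh : Real.cosh (Real.arsinh ((l - m) * S / r)) = (l + m) * C / r := by
    rw [Real.cosh_arsinh, Real.sqrt_eq_iff_mul_self_eq (by positivity) (by positivity)]
    field_simp; linarith
  refine ⟨Real.arsinh ((l - m) * S / r), ?_, r, hr0, ?_⟩
  · have : |(l - m) * S / r| ≤ S := by
      apply abs_le_of_sq_le_sq _ hS.le
      rw [div_pow, div_le_iff₀ (by positivity), hr2, hCS]
      nlinarith [mul_nonneg (mul_nonneg hl hm) (sq_nonneg S), mul_nonneg (mul_nonneg (mul_nonneg hl hm) (sq_nonneg S)) (sq_nonneg S), mul_nonneg (sq_nonneg S) (mul_nonneg hl hm)]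
    rw [abs_le] at this ⊢
    constructor
    · rw [← Real.sinh_le_sinh, hsinh, Real.sinh_neg]; exact this.1
    · rw [← Real.sinh_le_sinh, hsinh]; exact this.2
  · rw [hv, sub_eq_add_neg, hv, hv, hsinh, hcosh, Real.cosh_neg, Real.sinh_neg]
    simp only [smul_add, smul_smul]
    have e1 : r * ((l + m) * C / r) = l * C + m * C := by field_simp
    have e2 : r * ((l - m) * S / r) = l * S + m * -S := by field_simp; ring
    rw [e1, e2, add_smul, add_smul]
    abel

lemma tf_sep (A B C D : UpperHalfPlane) :
    (∃ l m l' m' : ℝ, 0 ≤ l ∧ 0 ≤ m ∧ 0 < l + m ∧ 0 ≤ l' ∧ 0 ≤ m' ∧ 0 < l' + m' ∧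
      l • tfX A + m • tfX B = l' • tfX C + m' • tfX D) ∨
    (∃ n, 0 < tfB n (tfX A) ∧ 0 < tfB n (tfX B) ∧ tfB n (tfX C) < 0 ∧ tfB n (tfX D) < 0) := by
  let k : UpperHalfPlane → ℝ × ℝ := fun z => (z.re, z.re ^ 2 + z.im ^ 2)
  have hk : ∀ z, z.im • tfX z = (1, k z) := by
    intro z
    have := z.im_ne_zero
    simp only [tfX, k, Prod.smul_mk, smul_eq_mul]
    ext <;> simp <;> field_simp
  by_cases hd : Disjoint (segment ℝ (k A) (k B)) (segment ℝ (k C) (k D))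
  · right
    have hc : ∀ x y : ℝ × ℝ, IsCompact (segment ℝ x y) := by
      intro x y
      rw [← convexHull_pair]
      exact (Set.toFinite ({x, y} : Set (ℝ × ℝ))).isCompact_convexHull ℝ
    obtain ⟨f, u, v, h1, h2, h3⟩ := geometric_hahn_banach_compact_closed (convex_segment _ _) (hc (k A) (k B)) (convex_segment _ _) (hc (k C) (k D)).isClosed hd
    have hf : ∀ x y : ℝ, f (x, y) = x * f (1, 0) + y * f (0, 1) := by
      intro x y
      have : ((x, y) : ℝ × ℝ) = x • (1, 0) + y • (0, 1) := by ext <;> simp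
      rw [this, map_add, map_smul, map_smul]; rfl
    have hn : ∀ z, tfB (-2 * f (0, 1), f (1, 0), 2 * u) (tfX z) = (u - f (k z)) / z.im := by
      intro z
      have := z.im_ne_zero
      have hz : f (k z) = z.re * f (1, 0) + (z.re ^ 2 + z.im ^ 2) * f (0, 1) := hf _ _
      rw [hz]
      simp only [tfB, tfX]
      field_simp; ring
    refine ⟨(-2 * f (0, 1), f (1, 0), 2 * u), ?_, ?_, ?_, ?_⟩ <;> rw [hn]
    · exact div_pos (by linarith [h1 _ (left_mem_segment ℝ (k A) (k B))]) A.im_pos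
    · exact div_pos (by linarith [h1 _ (right_mem_segment ℝ (k A) (k B))]) B.im_pos
    · exact div_neg_of_neg_of_pos (by linarith [h3 _ (left_mem_segment ℝ (k C) (k D))]) C.im_pos
    · exact div_neg_of_neg_of_pos (by linarith [h3 _ (right_mem_segment ℝ (k C) (k D))]) D.im_pos
  · left
    obtain ⟨x, ⟨l, m, hl, hm, hlm, h⟩, ⟨l', m', hl', hm', hlm', h'⟩⟩ := Set.not_disjoint_iff.1 hd
    have pos : ∀ (l m : ℝ) (A B : UpperHalfPlane), 0 ≤ l → 0 ≤ m → l + m = 1 → 0 < l * A.im + m * B.im := by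
      intro l m A B hl hm hlm
      have := A.im_pos
      have := B.im_pos
      rcases hl.eq_or_lt with rfl | hl
      · have : m = 1 := by linarith
        subst this; linarith
      · positivity
    refine ⟨l * A.im, m * B.im, l' * C.im, m' * D.im, mul_nonneg hl A.im_pos.le, mul_nonneg hm B.im_pos.le, pos _ _ _ _ hl hm hlm, mul_nonneg hl' C.im_pos.le, mul_nonneg hm' D.im_pos.le, pos _ _ _ _ hl' hm' hlm', ?_⟩
    rw [mul_smul, mul_smul, mul_smul, mul_smul, hk, hk, hk, hk]
    have e1 : l • ((1, k A) : ℝ × ℝ × ℝ) + m • ((1, k B) : ℝ × ℝ × ℝ) = (1, x) := by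
      rw [← h]; ext <;> simp [hlm]
    have e2 : l' • ((1, k C) : ℝ × ℝ × ℝ) + m' • ((1, k D) : ℝ × ℝ × ℝ) = (1, x) := by
      rw [← h']; ext <;> simp [hlm']
    rw [e1, e2]

lemma tf_foot (P v w : ℝ × ℝ × ℝ) (α β : ℝ → UpperHalfPlane) (a b : ℝ)
    (hP : tfB P P = 1) (hPv : tfB P v = 0) (hPw : tfB P w = 0)
    (hα : ∀ t, tfX (α (a + t)) = Real.cosh t • P + Real.sinh t • v)
    (hβ : ∀ t, tfX (β (b + t)) = Real.cosh t • P + Real.sinh t • w)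
    (hk : tfB v w ^ 2 ≤ 1) (t δ : ℝ) (hδ : 0 ≤ δ)
    (ht : Real.sinh t ^ 2 * (1 - tfB v w ^ 2) ≤ Real.sinh δ ^ 2) :
    Metric.infDist (α (a + t)) (Set.range β) ≤ δ := by
  set k := tfB v w
  set S := Real.sinh t
  set C := Real.cosh t
  have hC : C ^ 2 = S ^ 2 + 1 := Real.cosh_sq t
  have hC0 : 0 < C := Real.cosh_pos t
  have hpos : 0 < 1 + (1 - k ^ 2) * S ^ 2 := by nlinarith [sq_nonneg S, mul_nonneg (sub_nonneg.2 hk) (sq_nonneg S)]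
  set r := Real.sqrt (1 + (1 - k ^ 2) * S ^ 2)
  have hr0 : 0 < r := Real.sqrt_pos.2 hpos
  have hr2 : r ^ 2 = 1 + (1 - k ^ 2) * S ^ 2 := Real.sq_sqrt hpos.le
  have hsinh : Real.sinh (Real.arsinh (-k * S / r)) = -k * S / r := Real.sinh_arsinh _
  have hcosh : Real.cosh (Real.arsinh (-k * S / r)) = C / r := by
    rw [Real.cosh_arsinh, Real.sqrt_eq_iff_mul_self_eq (by positivity) (by positivity)]
    field_simp; linarith
  refine (Metric.infDist_le_dist_of_mem (Set.mem_range_self (b + Real.arsinh (-k * S / r)))).trans ?_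
  have hd : Real.cosh (dist (α (a + t)) (β (b + Real.arsinh (-k * S / r)))) = r := by
    rw [← tfX_dist, hα, hβ, hsinh, hcosh]
    simp only [tfB_add_left, tfB_add_right, tfB_smul_left, tfB_smul_right, hP, hPw, tfB_comm v P, hPv]
    change C / r * (C * 1 + S * 0) + -k * S / r * (C * 0 + S * k) = r
    field_simp
    linarith
  have h2 : r ≤ Real.cosh δ := by
    apply le_of_sq_le_sq _ (Real.cosh_pos δ).le
    rw [hr2, Real.cosh_sq]; linarith
  rw [← hd, Real.cosh_le_cosh] at h2
  rwa [abs_of_nonneg dist_nonneg, abs_of_nonneg hδ] at h2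

/-- Points near a point on the positive side of a line are not far on the negative side. -/
lemma tf_side (n : ℝ × ℝ × ℝ) (N ε : ℝ) (hN : 0 ≤ N) (hn : tfB n n = - N ^ 2) (hε : 0 < ε) (z z' : UpperHalfPlane)
    (hd : dist z' z ≤ ε) (h : 0 < tfB n (tfX z')) : - (N * Real.sinh ε) ≤ tfB n (tfX z) := by
  by_contra! hlt
  have hs : 0 < Real.sinh ε := Real.sinh_pos_iff.2 hε
  have hneg : tfB n (tfX z) < 0 := by nlinarith [mul_nonneg hN hs.le]
  have g := tf_gram n (tfX z) (tfX z')
  rw [tfX_self, tfX_self, hn, tfX_dist] at g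
  have h1 : Real.cosh (dist z z') ≤ Real.cosh ε := by
    rw [Real.cosh_le_cosh, abs_of_nonneg dist_nonneg, abs_of_pos hε, dist_comm]; exact hd
  have h0 := Real.one_le_cosh (dist z z')
  have h2 : Real.cosh (dist z z') ^ 2 - 1 ≤ Real.sinh ε ^ 2 := by
    rw [Real.sinh_sq]; nlinarith
  have h3 : 0 ≤ Real.cosh (dist z z') * (-(tfB n (tfX z)) * tfB n (tfX z')) := by
    apply mul_nonneg (by linarith) (mul_nonneg (by linarith) h.le)
  have h4 : N ^ 2 * (Real.cosh (dist z z') ^ 2 - 1) ≤ N ^ 2 * Real.sinh ε ^ 2 := by gcongr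
  have h5 : (N * Real.sinh ε) ^ 2 < tfB n (tfX z) ^ 2 := by
    rw [← neg_sq (tfB n (tfX z))]
    apply pow_lt_pow_left₀ (by linarith) (by positivity) (by norm_num)
  nlinarith [sq_nonneg (tfB n (tfX z'))]

set_option maxHeartbeats 2000000 in
theorem trap_forces_intersection
    (ε : ℝ) (hε : 0 < ε)
    (α β : ℝ → UpperHalfPlane)
    (hα : ∀ s t : ℝ, dist (α s) (α t) = |s - t|)
    (hβ : ∀ s t : ℝ, dist (β s) (β t) = |s - t|)
    (hne : Set.range α ≠ Set.range β)
    (hint : (Set.range α ∩ Set.range β).Nonempty)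
    (α' β' : ℝ → UpperHalfPlane)
    (hα' : ∀ s t : ℝ, dist (α' s) (α' t) = |s - t|)
    (hβ' : ∀ s t : ℝ, dist (β' s) (β' t) = |s - t|)
    (hcloseα : ∀ t ∈ {t : ℝ | Metric.infDist (α t) (Set.range β) ≤ 2 * ε},
      dist (α' t) (α t) ≤ ε)
    (hcloseβ : ∀ t ∈ {t : ℝ | Metric.infDist (β t) (Set.range α) ≤ 2 * ε},
      dist (β' t) (β t) ≤ ε) :
    ∃ s t : ℝ, α' s = β' t ∧
      Metric.infDist (α' s)
        (α '' {t : ℝ | Metric.infDist (α t) (Set.range β) ≤ 2 * ε}) ≤ ε := by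
  obtain ⟨p, ⟨a, ha⟩, ⟨b, hb⟩⟩ := hint
  obtain ⟨v, hPv, hvv, hav⟩ := tf_geod α hα a
  obtain ⟨w, hPw, hww, hbw⟩ := tf_geod β hβ b
  rw [ha] at hPv hav
  rw [hb] at hPw hbw
  have hP : tfB (tfX p) (tfX p) = 1 := tfX_self p
  have hk : tfB v w ^ 2 ≤ 1 := by
    have := tf_gram (tfX p) v w
    rw [hP, hPv, hPw, hvv, hww] at this
    linarith
  have hk1 : tfB v w ^ 2 ≠ 1 := by
    intro h
    apply hne
    have hinj : ∀ z z', tfX z = tfX z' → z = z' := fun z z' h =>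
      tfX_inj one_pos one_pos (by rw [h])
    rcases (by simpa using h : tfB v w = 1 ∨ tfB v w = -1) with h | h
    · have e : v + w = 0 := by
        apply tf_null (tfX p) _ hP
        · rw [tfB_add_right, hPv, hPw]; ring
        · simp only [tfB_add_right, tfB_add_left, hvv, hww, tfB_comm w v, h]; ring
      have e' : w = -v := (neg_eq_of_add_eq_zero_right e).symm
      have hpt : ∀ t, α (a + t) = β (b + -t) := by
        intro t
        apply hinj
        rw [hav, hbw, e', Real.cosh_neg, Real.sinh_neg, neg_smul_neg]
      ext z
      constructor
      · rintro ⟨t, rfl⟩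
        exact ⟨b + -(t - a), by rw [← hpt]; congr 1; ring⟩
      · rintro ⟨t, rfl⟩
        exact ⟨a + (b - t), by rw [hpt]; congr 1; ring⟩
    · have e : v - w = 0 := by
        apply tf_null (tfX p) _ hP
        · rw [tfB_sub_right, hPv, hPw]; ring
        · simp only [tfB_sub_right, tfB_sub_left, hvv, hww, tfB_comm w v, h]; ring
      have e' : v = w := sub_eq_zero.1 e
      have hpt : ∀ t, α (a + t) = β (b + t) := by
        intro t
        apply hinj
        rw [hav, hbw, e']
      ext z
      constructor
      · rintro ⟨t, rfl⟩
        exact ⟨b + (t - a), by rw [← hpt]; congr 1; ring⟩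
      · rintro ⟨t, rfl⟩
        exact ⟨a + (t - b), by rw [hpt]; congr 1; ring⟩
  have hk2 : 0 < 1 - tfB v w ^ 2 := by
    rw [sub_pos]; exact lt_of_le_of_ne hk hk1
  have hs2 : 0 < Real.sinh (2 * ε) := Real.sinh_pos_iff.2 (by linarith)
  obtain ⟨T, hT, hTs⟩ : ∃ T, 0 < T ∧ Real.sinh T ^ 2 * (1 - tfB v w ^ 2) = Real.sinh (2 * ε) ^ 2 := by
    refine ⟨Real.arsinh (Real.sinh (2 * ε) / Real.sqrt (1 - tfB v w ^ 2)), ?_, ?_⟩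
    · rw [Real.arsinh_pos_iff]; exact div_pos hs2 (Real.sqrt_pos.2 hk2)
    · rw [Real.sinh_arsinh, div_pow, Real.sq_sqrt hk2.le]; field_simp
  have hle : ∀ t, |t| ≤ T → Real.sinh t ^ 2 * (1 - tfB v w ^ 2) ≤ Real.sinh (2 * ε) ^ 2 := by
    intro t ht
    rw [← hTs]
    apply mul_le_mul_of_nonneg_right _ hk2.le
    apply sq_le_sq.2
    rw [Real.abs_sinh, Real.abs_sinh, Real.sinh_le_sinh, abs_of_pos hT]; exact ht
  have hI : ∀ t, |t| ≤ T → Metric.infDist (α (a + t)) (Set.range β) ≤ 2 * ε := fun t ht =>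
    tf_foot (tfX p) v w α β a b hP hPv hPw hav hbw hk t _ (by linarith) (hle t ht)
  have hJ : ∀ t, |t| ≤ T → Metric.infDist (β (b + t)) (Set.range α) ≤ 2 * ε := fun t ht =>
    tf_foot (tfX p) w v β α b a hP hPw hPv hbw hav (by rw [tfB_comm]; exact hk) t _ (by linarith)
      (by rw [tfB_comm w v]; exact hle t ht)
  have hTT : |T| ≤ T := (abs_of_pos hT).le
  have hTT' : |-T| ≤ T := by rw [abs_neg]; exact hTT
  rcases tf_sep (α' (a + T)) (α' (a - T)) (β' (b + T)) (β' (b - T)) with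
    ⟨l, m, l', m', hl, hm, hlm, hl', hm', hlm', heq⟩ | ⟨n, hA, hB, hC, hD⟩
  · obtain ⟨s, hs, r, hr, e1⟩ := tf_seg α' hα' a T hT l m hl hm hlm
    obtain ⟨t, ht, r', hr', e2⟩ := tf_seg β' hβ' b T hT l' m' hl' hm' hlm'
    refine ⟨a + s, b + t, tfX_inj hr hr' (by rw [← e1, ← e2, heq]), ?_⟩
    have hmem : (a + s) ∈ {t : ℝ | Metric.infDist (α t) (Set.range β) ≤ 2 * ε} := hI s hs
    exact (Metric.infDist_le_dist_of_mem (Set.mem_image_of_mem α hmem)).trans (hcloseα (a + s) hmem)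
  · exfalso
    have hNpos : 0 < - tfB n n := by
      have g := tf_gram n (tfX (α' (a + T))) (tfX (β' (b + T)))
      rw [tfX_self, tfX_self, tfX_dist] at g
      have h0 := Real.one_le_cosh (dist (α' (a + T)) (β' (b + T)))
      set c := Real.cosh (dist (α' (a + T)) (β' (b + T)))
      have h3 : 0 ≤ c * ((tfB n (tfX (α' (a + T)))) * -tfB n (tfX (β' (b + T)))) :=
        mul_nonneg (by linarith) (mul_nonneg hA.le (by linarith))
      have h4 : 0 < -tfB n n * (c ^ 2 - 1) := by nlinarith [pow_pos hA 2, sq_nonneg (tfB n (tfX (β' (b + T))))]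
      exact pos_of_mul_pos_left h4 (by nlinarith only [h0])
    set N := Real.sqrt (- tfB n n)
    have hN : 0 < N := Real.sqrt_pos.2 hNpos
    have hN2 : N ^ 2 = - tfB n n := Real.sq_sqrt hNpos.le
    have hn : tfB n n = - N ^ 2 := by linarith
    have hn' : tfB (-n) (-n) = - N ^ 2 := by rw [← hn]; simp only [tfB, Prod.fst_neg, Prod.snd_neg]; ring
    have hneg : ∀ x, tfB (-n) x = - tfB n x := by
      intro x; simp only [tfB, Prod.fst_neg, Prod.snd_neg]; ring
    have qA := tf_side n N ε hN.le hn hε _ _ (hcloseα (a + T) (hI T hTT)) hA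
    have qB := tf_side n N ε hN.le hn hε _ _ (hcloseα (a + -T) (hI (-T) hTT')) hB
    have qC := tf_side (-n) N ε hN.le hn' hε _ _ (hcloseβ (b + T) (hJ T hTT)) (by rw [hneg]; linarith)
    have qD := tf_side (-n) N ε hN.le hn' hε _ _ (hcloseβ (b + -T) (hJ (-T) hTT')) (by rw [hneg, ← sub_eq_add_neg]; linarith)
    rw [hneg] at qC qD
    rw [hav, tfB_add_right, tfB_smul_right, tfB_smul_right] at qA qB
    rw [hbw, tfB_add_right, tfB_smul_right, tfB_smul_right] at qC qD
    rw [Real.cosh_neg, Real.sinh_neg] at qB qD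
    have g4 := tf_gram4 n (tfX p) v w hP hPv hPw hvv hww
    have hST : 0 < Real.sinh T := Real.sinh_pos_iff.2 hT
    have hse : 0 < Real.sinh ε := Real.sinh_pos_iff.2 hε
    have hce : 1 < Real.cosh ε := Real.one_lt_cosh.2 hε.ne'
    have e1 : Real.sinh T * (|tfB n v| + |tfB n w|) ≤ 2 * N * Real.sinh ε := by
      rcases abs_cases (tfB n v) with ⟨h1, -⟩ | ⟨h1, -⟩ <;> rcases abs_cases (tfB n w) with ⟨h2, -⟩ | ⟨h2, -⟩ <;>
        rw [h1, h2] <;> linarith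
    have e2 : N ^ 2 * (1 - tfB v w ^ 2) ≤ (|tfB n v| + |tfB n w|) ^ 2 := by
      have h1 : tfB v w * (tfB n v * tfB n w) ≤ |tfB n v| * |tfB n w| := by
        refine (le_abs_self _).trans ?_
        rw [abs_mul, abs_mul]
        have : |tfB v w| ≤ 1 := by rwa [← sq_le_one_iff_abs_le_one]
        exact mul_le_of_le_one_left (by positivity) this
      have h2 := mul_nonneg (sq_nonneg (tfB n (tfX p))) hk2.le
      rw [add_sq, sq_abs, sq_abs]
      nlinarith
    have e3 : (Real.sinh T * (|tfB n v| + |tfB n w|)) ^ 2 ≤ (2 * N * Real.sinh ε) ^ 2 := by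
      apply pow_le_pow_left₀ (by positivity) e1
    have e4 : Real.sinh T ^ 2 * (N ^ 2 * (1 - tfB v w ^ 2)) ≤ Real.sinh T ^ 2 * (|tfB n v| + |tfB n w|) ^ 2 := by gcongr
    have e5 : N ^ 2 * Real.sinh (2 * ε) ^ 2 ≤ (2 * N * Real.sinh ε) ^ 2 := by
      rw [← hTs]; linarith
    have e6 : (2 * N * Real.sinh ε) ^ 2 < N ^ 2 * Real.sinh (2 * ε) ^ 2 := by
      rw [Real.sinh_two_mul, ← mul_pow]
      apply pow_lt_pow_left₀ _ (by positivity) (by norm_num)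
      have := mul_lt_mul_of_pos_left hce (by positivity : 0 < 2 * N * Real.sinh ε)
      linarith
    linarith
end

section
/- Let ε > 0 and let Γ be a subgroup of the isometry group of the hyperbolic plane ℍ with systole greater than 8ε, i.e. dist(x, g·x) > 8ε for every x ∈ ℍ and every g ∈ Γ with g ≠ 1. Let α : ℝ → ℍ be a complete geodesic, ℓ > 0, and a ∈ Γ with a·α(t) = α(t + ℓ) for all t (so α covers a closed geodesic γ of length ℓ on the quotient). Suppose γ has a transverse self-intersection: there exists g ∈ Γ such that the image g·(Set.range α) is distinct from Set.range α but meets it. Let L > 2ℓ + 4ε and let σ : [0, L] → ℍ be a geodesic segment (isometric embedding of [0, L]) that is ε-close to a segment of α, i.e. there is t₀ ∈ ℝ with dist(σ(t), α(t₀ + t)) ≤ ε for all t ∈ [0, L]. Then the projection of σ to the quotient has a transverse self-intersection: there exists h ∈ Γ with h ≠ 1 such that h·(Set.range σ) meets Set.range σ, and there is no complete geodesic in ℍ whose image contains both Set.range σ and h·(Set.range σ). -/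
open UpperHalfPlane

namespace StableSelf

/-- A unit speed complete geodesic. -/
def IsGeod (β : ℝ → UpperHalfPlane) : Prop := ∀ s t : ℝ, dist (β s) (β t) = |s - t|

/-- `r`, `y` are Fermi coordinates along the geodesic `β`. -/
structure Fermi (β : ℝ → UpperHalfPlane) (r y : UpperHalfPlane → ℝ) : Prop where
  cr : Continuous r
  cy : Continuous y
  cosh_d : ∀ z w, Real.cosh (dist z w) =
    Real.cosh (y z) * Real.cosh (y w) * Real.cosh (r z - r w) - Real.sinh (y z) * Real.sinh (y w)
  rb : ∀ t, r (β t) = t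
  yb : ∀ t, y (β t) = 0

/-- Minkowski form. -/
noncomputable def bil (z w : UpperHalfPlane) : ℝ :=
  ((z.re ^ 2 + z.im ^ 2) / z.im * (1 / w.im) + (w.re ^ 2 + w.im ^ 2) / w.im * (1 / z.im)) / 2
    - z.re / z.im * (w.re / w.im)

lemma cosh_dist_bil (z w : UpperHalfPlane) : Real.cosh (dist z w) = bil z w := by
  rw [UpperHalfPlane.cosh_dist', bil]
  have h1 := z.im_ne_zero
  have h2 := w.im_ne_zero
  field_simp
  ring

/-- determinant of three points of the hyperboloid. -/
noncomputable def det3 (e f z : UpperHalfPlane) : ℝ :=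
  (e.re ^ 2 + e.im ^ 2) / e.im * (1 / f.im * (z.re / z.im) - f.re / f.im * (1 / z.im))
  - 1 / e.im * ((f.re ^ 2 + f.im ^ 2) / f.im * (z.re / z.im)
      - f.re / f.im * ((z.re ^ 2 + z.im ^ 2) / z.im))
  + e.re / e.im * ((f.re ^ 2 + f.im ^ 2) / f.im * (1 / z.im)
      - 1 / f.im * ((z.re ^ 2 + z.im ^ 2) / z.im))

lemma gram_identity (e f z w : UpperHalfPlane) :
    det3 e f z * det3 e f w / 4 =
      bil e e * (bil f f * bil z w - bil f w * bil z f)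
      - bil e f * (bil e f * bil z w - bil f w * bil z e)
      + bil e w * (bil e f * bil z f - bil f f * bil z e) := by
  simp only [det3, bil]
  ring

lemma bil_self (z : UpperHalfPlane) : bil z z = 1 := by
  rw [← cosh_dist_bil]; simp

lemma bil_comm (z w : UpperHalfPlane) : bil z w = bil w z := by
  rw [← cosh_dist_bil, ← cosh_dist_bil, dist_comm]

lemma continuous_det3 (e f : UpperHalfPlane) : Continuous (det3 e f) := by
  have h1 : Continuous fun z : UpperHalfPlane => z.re := UpperHalfPlane.continuous_re
  have h2 : Continuous fun z : UpperHalfPlane => z.im := UpperHalfPlane.continuous_im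
  have h3 : ∀ z : UpperHalfPlane, z.im ≠ 0 := fun z => z.im_ne_zero
  unfold det3
  fun_prop (disch := assumption)

lemma exists_fermi (β : ℝ → UpperHalfPlane) (hβ : IsGeod β) : ∃ r y, Fermi β r y := by
  set k := Real.sinh 1 with hk
  have hkpos : 0 < k := Real.sinh_pos_iff.2 one_pos
  set b := Real.cosh 1 with hb
  have hbk : b ^ 2 = k ^ 2 + 1 := Real.cosh_sq 1
  have hef : bil (β 0) (β 1) = b := by
    rw [← cosh_dist_bil, hβ]; simp [hb]
  set C : UpperHalfPlane → ℝ := fun z => Real.cosh (dist z (β 0)) with hC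
  set S : UpperHalfPlane → ℝ := fun z => (b * C z - Real.cosh (dist z (β 1))) / k with hS
  set N : UpperHalfPlane → ℝ := fun z => det3 (β 0) (β 1) z / (2 * k) with hN
  have cC : Continuous C := Real.continuous_cosh.comp (continuous_id.dist continuous_const)
  have cS : Continuous S := ((continuous_const.mul cC).sub
    (Real.continuous_cosh.comp (continuous_id.dist continuous_const))).div_const _
  have cN : Continuous N := (continuous_det3 _ _).div_const _
  have main : ∀ z w, Real.cosh (dist z w) = C z * C w - S z * S w - N z * N w := by
    intro z w
    have h := gram_identity (β 0) (β 1) z w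
    rw [bil_self, bil_self, hef, bil_comm (β 0) w, bil_comm (β 1) w] at h
    have e1 : N z * N w = (det3 (β 0) (β 1) z * det3 (β 0) (β 1) w / 4) / k ^ 2 := by
      simp only [hN]; field_simp; ring
    rw [e1, h]
    simp only [hS, hC, cosh_dist_bil]
    field_simp
    linear_combination (bil z (β 0) * bil w (β 0) - bil z w) * hbk
  have hCb : ∀ t, C (β t) = Real.cosh t := by
    intro t; simp [hC, hβ t 0]
  have hSb : ∀ t, S (β t) = Real.sinh t := by
    intro t
    simp only [hS, hCb, hβ t 1, Real.cosh_abs, Real.cosh_sub]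
    field_simp; ring
  have hNb : ∀ t, N (β t) = 0 := by
    intro t
    have := main (β t) (β t)
    rw [dist_self, hCb, hSb, Real.cosh_zero] at this
    have h2 := Real.cosh_sq t
    have : N (β t) * N (β t) = 0 := by nlinarith
    simpa using this
  have hNp : ∀ z, 0 < Real.sqrt (1 + N z ^ 2) := fun z => Real.sqrt_pos.2 (by positivity)
  have hCr : ∀ z, C z = Real.sqrt (1 + N z ^ 2) *
      Real.cosh (Real.arsinh (S z / Real.sqrt (1 + N z ^ 2))) := by
    intro z
    have h1 : 0 < C z := Real.cosh_pos _
    have h := main z z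
    rw [dist_self, Real.cosh_zero] at h
    refine (sq_eq_sq₀ h1.le (mul_pos (hNp z) (Real.cosh_pos _)).le).1 ?_
    rw [mul_pow, Real.cosh_sq (Real.arsinh _), Real.sinh_arsinh, div_pow (S z)]
    have hq : Real.sqrt (1 + N z ^ 2) ^ 2 = 1 + N z ^ 2 := Real.sq_sqrt (by positivity)
    have : 1 + N z ^ 2 ≠ 0 := by positivity
    rw [hq, mul_add, mul_div_cancel₀ _ this]
    linarith
  have hSr : ∀ z, S z = Real.sqrt (1 + N z ^ 2) *
      Real.sinh (Real.arsinh (S z / Real.sqrt (1 + N z ^ 2))) := by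
    intro z
    rw [Real.sinh_arsinh]
    have := (hNp z).ne'
    field_simp
  refine ⟨fun z => Real.arsinh (S z / Real.sqrt (1 + N z ^ 2)), fun z => Real.arsinh (N z),
    ?_, ?_, ?_, ?_, ?_⟩
  · refine Continuous.arsinh (cS.div ?_ fun z => (hNp z).ne')
    exact Real.continuous_sqrt.comp (by fun_prop)
  · exact cN.arsinh
  · intro z w
    rw [main z w, Real.cosh_sub, Real.cosh_arsinh, Real.cosh_arsinh, Real.sinh_arsinh (N z),
      Real.sinh_arsinh (N w)]
    have c1 := hCr z
    have c2 := hCr w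
    have e := hSr z
    have e' := hSr w
    generalize Real.arsinh (S z / Real.sqrt (1 + N z ^ 2)) = R1 at *
    generalize Real.arsinh (S w / Real.sqrt (1 + N w ^ 2)) = R2 at *
    rw [c1, c2, e, e']
    ring
  · intro t; simp [hNb, hSb]
  · intro t; simp [hNb]

lemma Fermi.abs_r {β : ℝ → UpperHalfPlane} {r y : UpperHalfPlane → ℝ}
    (F : Fermi β r y) (z w) : |r z - r w| ≤ dist z w := by
  have h := F.cosh_d z w
  have : Real.cosh (r z - r w) ≤ Real.cosh (dist z w) := by
    have h1 := Real.one_le_cosh (r z - r w)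
    have h2 := Real.one_le_cosh (y z - y w)
    rw [Real.cosh_sub (y z)] at h2
    have h3 : 1 ≤ Real.cosh (y z) * Real.cosh (y w) :=
      one_le_mul_of_one_le_of_one_le (Real.one_le_cosh _) (Real.one_le_cosh _)
    nlinarith
  rw [Real.cosh_le_cosh] at this
  rwa [abs_of_nonneg (dist_nonneg (x := z) (y := w))] at this

lemma Fermi.abs_y {β : ℝ → UpperHalfPlane} {r y : UpperHalfPlane → ℝ}
    (F : Fermi β r y) (z w) : |y z - y w| ≤ dist z w := by
  have h := F.cosh_d z w
  have : Real.cosh (y z - y w) ≤ Real.cosh (dist z w) := by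
    have h1 := Real.one_le_cosh (r z - r w)
    have h3 : 0 < Real.cosh (y z) * Real.cosh (y w) := mul_pos (Real.cosh_pos _) (Real.cosh_pos _)
    rw [Real.cosh_sub (y z)]
    nlinarith
  rw [Real.cosh_le_cosh] at this
  rwa [abs_of_nonneg (dist_nonneg (x := z) (y := w))] at this

lemma Fermi.eq_of {β : ℝ → UpperHalfPlane} {r y : UpperHalfPlane → ℝ}
    (F : Fermi β r y) {z w} (hr : r z = r w) (hy : y z = y w) : z = w := by
  have h := F.cosh_d z w
  rw [hr, hy, sub_self, Real.cosh_zero] at h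
  have h2 := Real.cosh_sq (y w)
  have : Real.cosh (dist z w) = 1 := by nlinarith
  refine dist_eq_zero.1 (Real.cosh_strictMonoOn.injOn dist_nonneg (Set.mem_Ici.2 le_rfl) ?_)
  rw [this, Real.cosh_zero]

lemma Fermi.cosh_b {β : ℝ → UpperHalfPlane} {r y : UpperHalfPlane → ℝ}
    (F : Fermi β r y) (z t) : Real.cosh (dist z (β t)) = Real.cosh (y z) * Real.cosh (r z - t) := by
  rw [F.cosh_d, F.rb, F.yb]; simp

lemma Fermi.dist_foot {β : ℝ → UpperHalfPlane} {r y : UpperHalfPlane → ℝ}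
    (F : Fermi β r y) (z) : dist z (β (r z)) = |y z| := by
  have h := F.cosh_b z (r z)
  rw [sub_self, Real.cosh_zero, mul_one] at h
  have := Real.cosh_abs (y z)
  rw [← this] at h
  exact Real.cosh_strictMonoOn.injOn dist_nonneg (Set.mem_Ici.2 (abs_nonneg _)) h

lemma Fermi.dist_le {β : ℝ → UpperHalfPlane} {r y : UpperHalfPlane → ℝ}
    (F : Fermi β r y) (hβ : IsGeod β) (z t) : dist z (β t) ≤ |y z| + |r z - t| := by
  have := dist_triangle z (β (r z)) (β t)
  rwa [F.dist_foot, hβ] at this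

/-- Antipodal points with respect to `β 0` have opposite coordinates. -/
lemma Fermi.antipode {β : ℝ → UpperHalfPlane} {r y : UpperHalfPlane → ℝ}
    (F : Fermi β r y) {p q t} (hp : dist p (β 0) = t) (hq : dist q (β 0) = t)
    (hpq : dist p q = 2 * t) : r q = - r p ∧ y q = - y p := by
  have h1 := F.cosh_b p 0
  have h2 := F.cosh_b q 0
  have h3 := F.cosh_d p q
  rw [hp, sub_zero] at h1
  rw [hq, sub_zero] at h2
  rw [hpq, Real.cosh_two_mul, Real.cosh_sub] at h3
  have a1 := Real.cosh_sq t
  have a2 := Real.cosh_sq (y p)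
  have a3 := Real.cosh_sq (y q)
  have a4 := Real.cosh_sq (r p)
  have a5 := Real.cosh_sq (r q)
  have key : (Real.cosh (y p) * Real.sinh (r p) + Real.cosh (y q) * Real.sinh (r q)) ^ 2 +
      (Real.sinh (y p) + Real.sinh (y q)) ^ 2 = 0 := by
    have b1 : (Real.cosh (y p) * Real.sinh (r p)) ^ 2 + Real.sinh (y p) ^ 2 = Real.sinh t ^ 2 := by
      have : Real.cosh t ^ 2 = Real.cosh (y p) ^ 2 * Real.cosh (r p) ^ 2 := by rw [h1]; ring
      rw [mul_pow]; nlinarith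
    have b2 : (Real.cosh (y q) * Real.sinh (r q)) ^ 2 + Real.sinh (y q) ^ 2 = Real.sinh t ^ 2 := by
      have : Real.cosh t ^ 2 = Real.cosh (y q) ^ 2 * Real.cosh (r q) ^ 2 := by rw [h2]; ring
      rw [mul_pow]; nlinarith
    have b3 : Real.cosh t ^ 2 = Real.cosh (y p) * Real.cosh (r p) *
        (Real.cosh (y q) * Real.cosh (r q)) := by rw [← h1, ← h2]; ring
    linear_combination b1 + b2 + 2 * h3 - 2 * b3
  have k1 : Real.sinh (y p) + Real.sinh (y q) = 0 := by
    have : (Real.sinh (y p) + Real.sinh (y q)) ^ 2 = 0 :=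
      le_antisymm (by nlinarith [sq_nonneg (Real.cosh (y p) * Real.sinh (r p) +
        Real.cosh (y q) * Real.sinh (r q))]) (sq_nonneg _)
    simpa using this
  have hy : y q = - y p := by
    apply Real.sinh_injective
    rw [Real.sinh_neg]; linarith
  have k2 : Real.cosh (y p) * Real.sinh (r p) + Real.cosh (y q) * Real.sinh (r q) = 0 := by
    rw [k1] at key
    simpa using key
  rw [hy, Real.cosh_neg, ← mul_add] at k2
  have k3 := (mul_eq_zero.1 k2).resolve_left (Real.cosh_pos _).ne'
  refine ⟨?_, hy⟩
  apply Real.sinh_injective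
  rw [Real.sinh_neg]; linarith

/-- determinant of three points in Fermi coordinates -/
noncomputable def fdet (r y : UpperHalfPlane → ℝ) (p q z : UpperHalfPlane) : ℝ :=
  Real.cosh (y p) * Real.cosh (r p) *
    (Real.cosh (y q) * Real.sinh (r q) * Real.sinh (y z)
      - Real.sinh (y q) * (Real.cosh (y z) * Real.sinh (r z)))
  - Real.cosh (y p) * Real.sinh (r p) *
    (Real.cosh (y q) * Real.cosh (r q) * Real.sinh (y z)
      - Real.sinh (y q) * (Real.cosh (y z) * Real.cosh (r z)))
  + Real.sinh (y p) * (Real.cosh (y q) * Real.cosh (r q) * (Real.cosh (y z) * Real.sinh (r z))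
      - Real.cosh (y q) * Real.sinh (r q) * (Real.cosh (y z) * Real.cosh (r z)))

lemma gram_alg (a1 b1 c1 a2 b2 c2 a3 b3 c3 x y z : ℝ)
    (h1 : 1 = a1 * a1 - b1 * b1 - c1 * c1) (h2 : 1 = a2 * a2 - b2 * b2 - c2 * c2)
    (h3 : 1 = a3 * a3 - b3 * b3 - c3 * c3)
    (h12 : x = a1 * a2 - b1 * b2 - c1 * c2) (h13 : y = a1 * a3 - b1 * b3 - c1 * c3)
    (h23 : z = a2 * a3 - b2 * b3 - c2 * c3) :
    (a1 * (b2 * c3 - c2 * b3) - b1 * (a2 * c3 - c2 * a3) + c1 * (a2 * b3 - b2 * a3)) ^ 2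
      = 1 + 2 * x * y * z - x ^ 2 - y ^ 2 - z ^ 2 := by
  have : (1 : ℝ) + 2 * x * y * z - x ^ 2 - y ^ 2 - z ^ 2 =
    (a1 * a1 - b1 * b1 - c1 * c1) * (a2 * a2 - b2 * b2 - c2 * c2) * (a3 * a3 - b3 * b3 - c3 * c3)
     + 2 * x * y * z - x ^ 2 * (a3 * a3 - b3 * b3 - c3 * c3)
      - y ^ 2 * (a2 * a2 - b2 * b2 - c2 * c2) - z ^ 2 * (a1 * a1 - b1 * b1 - c1 * c1) := by
    rw [← h1, ← h2, ← h3]; ring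
  rw [this, h12, h13, h23]; ring

lemma fdet_eq_zero {β : ℝ → UpperHalfPlane} {r y : UpperHalfPlane → ℝ} (F : Fermi β r y)
    {p q z : UpperHalfPlane} {t1 t2 t3 : ℝ} (h12 : dist p q = |t1 - t2|)
    (h13 : dist p z = |t1 - t3|) (h23 : dist q z = |t2 - t3|) : fdet r y p q z = 0 := by
  have d : ∀ z w, Real.cosh (dist z w) = Real.cosh (y z) * Real.cosh (r z) *
      (Real.cosh (y w) * Real.cosh (r w)) - Real.cosh (y z) * Real.sinh (r z) *
      (Real.cosh (y w) * Real.sinh (r w)) - Real.sinh (y z) * Real.sinh (y w) := by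
    intro z w; rw [F.cosh_d, Real.cosh_sub]; ring
  have e1 := d p p
  have e2 := d q q
  have e3 := d z z
  rw [dist_self, Real.cosh_zero] at e1 e2 e3
  have h := gram_alg _ _ _ _ _ _ _ _ _ _ _ _ e1 e2 e3 (d p q) (d p z) (d q z)
  rw [h12, h13, h23, Real.cosh_abs, Real.cosh_abs, Real.cosh_abs] at h
  have e : t1 - t3 = (t1 - t2) + (t2 - t3) := by ring
  rw [e, Real.cosh_add] at h
  have s1 := Real.cosh_sq (t1 - t2)
  have s2 := Real.cosh_sq (t2 - t3)
  have : fdet r y p q z ^ 2 = 0 := by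
    unfold fdet
    rw [h]
    generalize Real.cosh (t1 - t2) = A at *
    generalize Real.cosh (t2 - t3) = B at *
    generalize Real.sinh (t1 - t2) = A' at *
    generalize Real.sinh (t2 - t3) = B' at *
    have g1 : A' ^ 2 = A ^ 2 - 1 := by linarith
    have g2 : B' ^ 2 = B ^ 2 - 1 := by linarith
    have : (A' * B') ^ 2 = (A ^ 2 - 1) * (B ^ 2 - 1) := by rw [mul_pow, g1, g2]
    linear_combination -this
  simpa using this

/-- If `z`, `w` have the same foot, `fdet p q w = 0`, then ... -/
lemma fdet_same_foot {r y : UpperHalfPlane → ℝ} {p q z w : UpperHalfPlane} (hr : r w = r z)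
    (hw : fdet r y p q w = 0) :
    fdet r y p q z * Real.cosh (y w) =
      Real.cosh (y p) * Real.cosh (y q) * Real.sinh (r q - r p) * Real.sinh (y z - y w) := by
  have : fdet r y p q z * Real.cosh (y w) =
      fdet r y p q z * Real.cosh (y w) - fdet r y p q w * Real.cosh (y z) := by rw [hw]; ring
  rw [this, Real.sinh_sub, Real.sinh_sub]
  unfold fdet
  rw [hr]; ring

lemma fdet_continuous {β : ℝ → UpperHalfPlane} {r y : UpperHalfPlane → ℝ} (F : Fermi β r y)
    (p q : UpperHalfPlane) : Continuous (fdet r y p q) := by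
  have h1 := F.cr
  have h2 := F.cy
  unfold fdet
  fun_prop

lemma range_subset {γ δ : ℝ → UpperHalfPlane} (hγ : IsGeod γ) (hδ : IsGeod δ) (h0 : γ 0 = δ 0)
    {t1 t2 : ℝ} (h1 : t1 ≠ 0) (h : γ t1 = δ t2) : Set.range γ ⊆ Set.range δ := by
  obtain ⟨r, y, F⟩ := exists_fermi δ hδ
  rintro _ ⟨t, rfl⟩
  have ht : |t1| = |t2| := by
    have a := hγ t1 0
    have b := hδ t2 0
    rw [h0, h, b] at a
    simpa using a.symm
  have e1 := F.cosh_b (γ t) 0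
  have e2 := F.cosh_b (γ t) t2
  rw [← h0, hγ, Real.cosh_abs, sub_zero, sub_zero] at e1
  rw [← h, hγ, Real.cosh_abs, Real.cosh_sub, Real.cosh_sub] at e2
  have c1 : Real.cosh t1 = Real.cosh t2 := by rw [← Real.cosh_abs t1, ht, Real.cosh_abs]
  have s1 : Real.sinh t1 ^ 2 = Real.sinh t2 ^ 2 := by
    have := Real.cosh_sq t1
    have := Real.cosh_sq t2
    rw [c1] at *; linarith
  have s0 : Real.sinh t2 ≠ 0 := by
    intro hh; rw [hh] at s1
    exact h1 (Real.sinh_eq_zero.1 (by simpa using s1))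
  have e3 : Real.sinh t * Real.sinh t1 = Real.cosh (y (γ t)) * Real.sinh (r (γ t)) * Real.sinh t2 := by
    rw [c1, e1] at e2; linarith
  have e4 : Real.sinh t ^ 2 = (Real.cosh (y (γ t)) * Real.sinh (r (γ t))) ^ 2 := by
    have : Real.sinh t ^ 2 * Real.sinh t2 ^ 2 =
      (Real.cosh (y (γ t)) * Real.sinh (r (γ t))) ^ 2 * Real.sinh t2 ^ 2 := by
      rw [← mul_pow (Real.cosh _ * _), ← e3, mul_pow, s1]
    exact mul_right_cancel₀ (pow_ne_zero 2 s0) this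
  have a1 := Real.cosh_sq t
  have a2 := Real.cosh_sq (y (γ t))
  have a3 := Real.cosh_sq (r (γ t))
  have e5 : Real.cosh t ^ 2 = Real.cosh (y (γ t)) ^ 2 * Real.cosh (r (γ t)) ^ 2 := by rw [e1]; ring
  have e6 : Real.sinh (y (γ t)) ^ 2 = 0 := by rw [mul_pow] at e4; nlinarith
  have e7 : y (γ t) = 0 := Real.sinh_eq_zero.1 (by simpa using e6)
  exact ⟨r (γ t), F.eq_of (F.rb _) (by rw [F.yb, e7])⟩

lemma range_eq {γ δ : ℝ → UpperHalfPlane} (hγ : IsGeod γ) (hδ : IsGeod δ) (h0 : γ 0 = δ 0)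
    {t1 t2 : ℝ} (h1 : t1 ≠ 0) (h : γ t1 = δ t2) : Set.range γ = Set.range δ := by
  have h2 : t2 ≠ 0 := by
    have a := hγ t1 0
    have b := hδ t2 0
    rw [h0, h, b] at a
    rintro rfl
    simp at a
    exact h1 (abs_eq_zero.1 a.symm)
  exact (range_subset hγ hδ h0 h1 h).antisymm (range_subset hδ hγ h0.symm h2 h.symm)

/-- Two different lifts diverge by more than `2ε` on half a period. -/
lemma far (ε : ℝ) (Γ : Subgroup (UpperHalfPlane ≃ᵢ UpperHalfPlane))
    (hsys : ∀ (x : UpperHalfPlane), ∀ g ∈ Γ, g ≠ 1 → 8 * ε < dist x (g x))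
    (A β : ℝ → UpperHalfPlane) (hA : IsGeod A) (hβ : IsGeod β) (h0 : A 0 = β 0)
    (ℓ : ℝ) (hℓ : 0 < ℓ) (a b : UpperHalfPlane ≃ᵢ UpperHalfPlane) (ha : a ∈ Γ) (hb : b ∈ Γ)
    (haA : ∀ t, a (A t) = A (t + ℓ)) (hbβ : ∀ t, b (β t) = β (t + ℓ))
    (hne : Set.range A ≠ Set.range β) {r y} (F : Fermi β r y) :
    2 * ε < |y (A (ℓ / 2))| ∧ y (A (-(ℓ / 2))) = - y (A (ℓ / 2)) := by
  obtain ⟨hr, hy⟩ := F.antipode (p := A (ℓ / 2)) (q := A (-(ℓ / 2))) (t := ℓ / 2)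
    (by rw [← h0, hA, sub_zero, abs_of_pos (by linarith)])
    (by rw [← h0, hA, sub_zero, abs_neg, abs_of_pos (by linarith)])
    (by rw [hA, abs_of_pos (by linarith)]; ring)
  refine ⟨?_, hy⟩
  by_contra! hcon
  set p := A (ℓ / 2) with hp
  set q := A (-(ℓ / 2)) with hq
  have hap : a q = p := by rw [hq, haA, hp]; congr 1; ring
  have hp0 : dist p (β 0) = ℓ / 2 := by
    rw [← h0, hA, sub_zero, abs_of_pos (by linarith)]
  have r1 : |r p| ≤ ℓ / 2 := by
    have := F.abs_r p (β 0)
    rwa [F.rb, sub_zero, hp0] at this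
  have r2 : ℓ / 2 ≤ |y p| + |r p| := by
    have := F.dist_le hβ p 0
    rwa [hp0, sub_zero] at this
  -- the general step
  have step : ∀ c ∈ Γ, ∀ ρ : ℝ, ρ ≠ 0 → (∀ t, c (β t) = β (t + 2 * ρ)) →
      dist p (β ρ) ≤ 4 * ε → dist q (β (-ρ)) ≤ 4 * ε → False := by
    intro c hc ρ hρ hcβ d1 d2
    have hd : dist q ((c⁻¹ * a) q) ≤ 8 * ε := by
      have e1 : dist q ((c⁻¹ * a) q) = dist (c q) (a q) := by
        rw [← c.isometry.dist_eq, IsometryEquiv.mul_apply, IsometryEquiv.apply_inv_self]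
      have e2 : dist (c q) (β ρ) ≤ 4 * ε := by
        have : c (β (-ρ)) = β ρ := by rw [hcβ]; congr 1; ring
        rw [← this, c.isometry.dist_eq]; exact d2
      rw [e1, hap]
      have := dist_triangle_right (c q) p (β ρ)
      linarith
    have hca : c⁻¹ * a = 1 := by
      by_contra hh
      have := hsys q _ (Γ.mul_mem (Γ.inv_mem hc) ha) hh
      linarith
    have hca : a = c := by rw [inv_mul_eq_one] at hca; exact hca.symm
    have e : A ℓ = β (2 * ρ) := by
      have h1 := haA 0
      have h2 := hcβ 0
      rw [zero_add] at h1 h2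
      rw [← h1, ← h2, h0, hca]
    exact hne (range_eq hA hβ h0 hℓ.ne' e)
  have d2 : ∀ ρ, dist q (β (-ρ)) = dist p (β ρ) := by
    intro ρ
    refine Real.cosh_strictMonoOn.injOn dist_nonneg dist_nonneg ?_
    rw [F.cosh_b, F.cosh_b, hr, hy, Real.cosh_neg, ← Real.cosh_neg (-r p - -ρ)]
    congr 2; ring
  rcases le_total 0 (r p) with hs | hs
  · have d1 : dist p (β (ℓ / 2)) ≤ 4 * ε := by
      have := F.dist_le hβ p (ℓ / 2)
      rw [abs_of_nonneg hs] at r1 r2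
      rw [abs_of_nonpos (by linarith : r p - ℓ / 2 ≤ 0)] at this
      linarith
    exact step b hb (ℓ / 2) (by positivity) (fun t => by rw [hbβ]; congr 1; ring) d1
      (by rw [d2]; exact d1)
  · have d1 : dist p (β (-(ℓ / 2))) ≤ 4 * ε := by
      have := F.dist_le hβ p (-(ℓ / 2))
      rw [abs_of_nonpos hs] at r1 r2
      rw [abs_of_nonneg (by linarith : 0 ≤ r p - -(ℓ / 2))] at this
      linarith
    refine step b⁻¹ (Γ.inv_mem hb) (-(ℓ / 2)) (by linarith [hℓ] : -(ℓ/2) < 0).ne (fun t => ?_) d1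
      (by rw [d2]; exact d1)
    have : β t = b (β (t + 2 * -(ℓ / 2))) := by rw [hbβ]; congr 1; ring
    rw [this, IsometryEquiv.inv_apply_self]

/-- Main crossing lemma. `σ`, `τ` segments near `A` and `β`. -/
lemma crossing (ε : ℝ) (hε : 0 < ε) (A β : ℝ → UpperHalfPlane) (hA : IsGeod A) (h0 : A 0 = β 0)
    (ℓ : ℝ) (hℓ : 0 < ℓ) {r y} (F : Fermi β r y)
    (hfar : 2 * ε < |y (A (ℓ / 2))|) (hanti : y (A (-(ℓ / 2))) = - y (A (ℓ / 2)))
    (L s u : ℝ) (hs0 : ℓ / 2 + 2 * ε < s) (hsL : s + (ℓ / 2 + 2 * ε) < L)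
    (hu0 : ℓ / 2 + 2 * ε < u) (huL : u + (ℓ / 2 + 2 * ε) < L)
    (σ τ : Set.Icc (0 : ℝ) L → UpperHalfPlane)
    (hσ : ∀ s t : Set.Icc (0 : ℝ) L, dist (σ s) (σ t) = |(s : ℝ) - (t : ℝ)|)
    (hτ : ∀ s t : Set.Icc (0 : ℝ) L, dist (τ s) (τ t) = |(s : ℝ) - (t : ℝ)|)
    (hσA : ∀ t : Set.Icc (0 : ℝ) L, dist (σ t) (A (t - s)) ≤ ε)
    (hτβ : ∀ t : Set.Icc (0 : ℝ) L, dist (τ t) (β (t - u)) ≤ ε) :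
    (Set.range τ ∩ Set.range σ).Nonempty ∧
      ¬ ∃ γ : ℝ → UpperHalfPlane, IsGeod γ ∧
        Set.range σ ⊆ Set.range γ ∧ Set.range τ ⊆ Set.range γ := by
  have hL : 0 ≤ L := by linarith
  set z0 : Set.Icc (0 : ℝ) L := ⟨0, le_refl _, hL⟩ with hz0
  set zL : Set.Icc (0 : ℝ) L := ⟨L, hL, le_refl _⟩ with hzL
  have cσ : Continuous σ := (Isometry.of_dist_eq fun s t => by rw [hσ]; rfl : Isometry σ).continuous
  have cτ : Continuous τ := (Isometry.of_dist_eq fun s t => by rw [hτ]; rfl : Isometry τ).continuous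
  have r0 : r (τ z0) ≤ -u + ε := by
    have := (abs_le.1 ((F.abs_r (τ z0) (β (z0 - u))).trans (hτβ z0))).2
    rw [F.rb] at this
    simp only [hz0] at this ⊢
    linarith
  have rL : L - u - ε ≤ r (τ zL) := by
    have := (abs_le.1 ((F.abs_r (τ zL) (β (zL - u))).trans (hτβ zL))).1
    rw [F.rb] at this
    simp only [hzL] at this ⊢
    linarith
  have yτ : ∀ t, |y (τ t)| ≤ ε := by
    intro t
    have := (F.abs_y (τ t) (β (t - u))).trans (hτβ t)
    rwa [F.yb, sub_zero] at this
  have : Fact ((0 : ℝ) ≤ L) := ⟨hL⟩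
  have foot : ∀ t : Set.Icc (0 : ℝ) L, |(t : ℝ) - s| ≤ ℓ / 2 → ∃ t', r (τ t') = r (σ t) := by
    intro t ht
    have h1 := abs_le.1 ((F.abs_r (σ t) (A (t - s))).trans (hσA t))
    have h2 : |r (A (t - s))| ≤ ℓ / 2 := by
      have := F.abs_r (A (t - s)) (β 0)
      rw [← h0, hA, h0, F.rb, sub_zero, sub_zero] at this
      exact this.trans ht
    have h2 := abs_le.1 h2
    have := mem_range_of_exists_le_of_exists_ge (F.cr.comp cτ) (c := r (σ t))
      ⟨z0, by simp only [Function.comp]; linarith⟩ ⟨zL, by simp only [Function.comp]; linarith⟩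
    exact this
  set G : UpperHalfPlane → ℝ := fdet r y (τ z0) (τ zL) with hG
  have Gτ : ∀ t, G (τ t) = 0 := fun t => fdet_eq_zero F (hτ _ _) (hτ _ _) (hτ _ _)
  have n2 : 0 < Real.cosh (y (τ z0)) * Real.cosh (y (τ zL)) *
      Real.sinh (r (τ zL) - r (τ z0)) :=
    mul_pos (mul_pos (Real.cosh_pos _) (Real.cosh_pos _)) (Real.sinh_pos_iff.2 (by linarith))
  set tp : Set.Icc (0 : ℝ) L := ⟨s + ℓ / 2, by linarith, by linarith⟩ with htp
  set tm : Set.Icc (0 : ℝ) L := ⟨s - ℓ / 2, by linarith, by linarith⟩ with htm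
  have ap : |(tp : ℝ) - s| ≤ ℓ / 2 := by
    simp only [htp, add_sub_cancel_left]; rw [abs_of_pos (by linarith)]
  have am : |(tm : ℝ) - s| ≤ ℓ / 2 := by
    simp only [htm]; rw [show s - ℓ / 2 - s = -(ℓ / 2) by ring, abs_neg, abs_of_pos (by linarith)]
  have yp : |y (σ tp) - y (A (ℓ / 2))| ≤ ε := by
    have := (F.abs_y (σ tp) (A (tp - s))).trans (hσA tp)
    rwa [show (tp : ℝ) - s = ℓ / 2 by simp [htp]] at this
  have ym : |y (σ tm) + y (A (ℓ / 2))| ≤ ε := by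
    have := (F.abs_y (σ tm) (A (tm - s))).trans (hσA tm)
    rwa [show (tm : ℝ) - s = -(ℓ / 2) by simp [htm], hanti, sub_neg_eq_add] at this
  have pos : ∀ t : Set.Icc (0 : ℝ) L, |(t : ℝ) - s| ≤ ℓ / 2 → ε < y (σ t) → 0 < G (σ t) := by
    intro t ht hy
    obtain ⟨t', ht'⟩ := foot t ht
    have e := fdet_same_foot (p := τ z0) (q := τ zL) ht' (Gτ t')
    have h2 := (abs_le.1 (yτ t')).2
    have : 0 < Real.sinh (y (σ t) - y (τ t')) := Real.sinh_pos_iff.2 (by linarith)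
    have h3 := mul_pos n2 this
    rw [← e] at h3
    exact pos_of_mul_pos_left h3 (Real.cosh_pos _).le
  have neg : ∀ t : Set.Icc (0 : ℝ) L, |(t : ℝ) - s| ≤ ℓ / 2 → y (σ t) < -ε → G (σ t) < 0 := by
    intro t ht hy
    obtain ⟨t', ht'⟩ := foot t ht
    have e := fdet_same_foot (p := τ z0) (q := τ zL) ht' (Gτ t')
    have h2 := (abs_le.1 (yτ t')).1
    have : Real.sinh (y (σ t) - y (τ t')) < 0 := Real.sinh_neg_iff.2 (by linarith)
    have h3 := mul_neg_of_pos_of_neg n2 this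
    rw [← e] at h3
    exact (neg_iff_pos_of_mul_neg h3).2 (Real.cosh_pos _)
  have cG : Continuous (G ∘ σ) := (fdet_continuous F _ _).comp cσ
  have hsign : (0 < G (σ tp) ∧ G (σ tm) < 0) ∨ (G (σ tp) < 0 ∧ 0 < G (σ tm)) := by
    have yp := abs_le.1 yp
    have ym := abs_le.1 ym
    rcases lt_abs.1 hfar with h | h
    · exact Or.inl ⟨pos tp ap (by linarith), neg tm am (by linarith)⟩
    · exact Or.inr ⟨neg tp ap (by linarith), pos tm am (by linarith)⟩
  constructor
  · -- intermediate value
    have hle : tm ≤ tp := by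
      show s - ℓ / 2 ≤ s + ℓ / 2
      linarith
    obtain ⟨t, ht, hGt⟩ : ∃ t ∈ Set.Icc (s - ℓ / 2) (s + ℓ / 2),
        G (σ (Set.projIcc 0 L hL t)) = 0 := by
      have cc : Continuous fun t => G (σ (Set.projIcc 0 L hL t)) := cG.comp continuous_projIcc
      have e1 : Set.projIcc 0 L hL (s - ℓ / 2) = tm := Set.projIcc_of_mem hL tm.2
      have e2 : Set.projIcc 0 L hL (s + ℓ / 2) = tp := Set.projIcc_of_mem hL tp.2
      rcases hsign with h | h
      · have := intermediate_value_Icc (by linarith : s - ℓ / 2 ≤ s + ℓ / 2) cc.continuousOn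
        obtain ⟨t, ht, h'⟩ := this (show (0 : ℝ) ∈ _ by rw [e1, e2]; exact ⟨h.2.le, h.1.le⟩)
        exact ⟨t, ht, h'⟩
      · have := intermediate_value_Icc' (by linarith : s - ℓ / 2 ≤ s + ℓ / 2) cc.continuousOn
        obtain ⟨t, ht, h'⟩ := this (show (0 : ℝ) ∈ _ by rw [e1, e2]; exact ⟨h.1.le, h.2.le⟩)
        exact ⟨t, ht, h'⟩
    have htmem : t ∈ Set.Icc 0 L := ⟨by linarith [ht.1], by linarith [ht.2]⟩
    rw [Set.projIcc_of_mem hL htmem] at hGt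
    obtain ⟨t', ht'⟩ := foot ⟨t, htmem⟩ (abs_le.2 ⟨by simp only; linarith [ht.1],
      by simp only; linarith [ht.2]⟩)
    have e := fdet_same_foot (p := τ z0) (q := τ zL) ht' (Gτ t')
    rw [← hG, hGt, zero_mul] at e
    have h3 := (mul_eq_zero.1 e.symm).resolve_left n2.ne'
    have h4 : y (σ ⟨t, htmem⟩) = y (τ t') := sub_eq_zero.1 (Real.sinh_eq_zero.1 h3)
    have h5 := F.eq_of ht' h4.symm
    exact ⟨τ t', ⟨t', rfl⟩, h5 ▸ ⟨_, rfl⟩⟩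
  · rintro ⟨γ, hγ, h1, h2⟩
    obtain ⟨x0, e0⟩ := h2 ⟨z0, rfl⟩
    obtain ⟨xL, eL⟩ := h2 ⟨zL, rfl⟩
    obtain ⟨xp, ep⟩ := h1 ⟨tp, rfl⟩
    have : G (σ tp) = 0 := by
      rw [hG, ← e0, ← eL, ← ep]
      exact fdet_eq_zero F (hγ _ _) (hγ _ _) (hγ _ _)
    rcases hsign with h | h
    · exact h.1.ne' this
    · exact h.1.ne this

lemma zpow_shift {α : ℝ → UpperHalfPlane} {ℓ : ℝ} {a : UpperHalfPlane ≃ᵢ UpperHalfPlane}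
    (haα : ∀ t : ℝ, a (α t) = α (t + ℓ)) (n : ℤ) : ∀ t, (a ^ n) (α t) = α (t + n * ℓ) := by
  have hinv : ∀ t, a⁻¹ (α t) = α (t - ℓ) := by
    intro t
    have : α t = a (α (t - ℓ)) := by rw [haα]; congr 1; ring
    rw [this, IsometryEquiv.inv_apply_self]
  induction n with
  | zero => intro t; simp
  | succ n ih =>
    intro t
    rw [zpow_add_one, IsometryEquiv.mul_apply, haα, ih]
    congr 1; push_cast; ring
  | pred n ih =>
    intro t
    rw [zpow_sub_one, IsometryEquiv.mul_apply, hinv, ih]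
    congr 1; push_cast; ring

lemma image_zpow {α : ℝ → UpperHalfPlane} {ℓ : ℝ} {a : UpperHalfPlane ≃ᵢ UpperHalfPlane}
    (haα : ∀ t : ℝ, a (α t) = α (t + ℓ)) (n : ℤ) : (a ^ n) '' Set.range α = Set.range α := by
  ext z; constructor
  · rintro ⟨_, ⟨t, rfl⟩, rfl⟩
    exact ⟨_, (zpow_shift haα n t).symm⟩
  · rintro ⟨t, rfl⟩
    refine ⟨α (t - n * ℓ), ⟨_, rfl⟩, ?_⟩
    rw [zpow_shift haα]; congr 1; ring

end StableSelf

open StableSelf in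
theorem stable_self_intersection
    (ε : ℝ) (hε : 0 < ε)
    (Γ : Subgroup (UpperHalfPlane ≃ᵢ UpperHalfPlane))
    (hsys : ∀ (x : UpperHalfPlane), ∀ g ∈ Γ, g ≠ 1 → 8 * ε < dist x (g x))
    (α : ℝ → UpperHalfPlane)
    (hα : ∀ s t : ℝ, dist (α s) (α t) = |s - t|)
    (ℓ : ℝ) (hℓ : 0 < ℓ)
    (a : UpperHalfPlane ≃ᵢ UpperHalfPlane) (ha : a ∈ Γ)
    (haα : ∀ t : ℝ, a (α t) = α (t + ℓ))
    (hself : ∃ g ∈ Γ, g '' (Set.range α) ≠ Set.range α ∧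
      (g '' (Set.range α) ∩ Set.range α).Nonempty)
    (L : ℝ) (hL : 2 * ℓ + 4 * ε < L)
    (σ : Set.Icc (0 : ℝ) L → UpperHalfPlane)
    (hσ : ∀ s t : Set.Icc (0 : ℝ) L, dist (σ s) (σ t) = |(s : ℝ) - (t : ℝ)|)
    (hclose : ∃ t₀ : ℝ, ∀ t : Set.Icc (0 : ℝ) L, dist (σ t) (α (t₀ + t)) ≤ ε) :
    ∃ h ∈ Γ, h ≠ 1 ∧
      (h '' (Set.range σ) ∩ Set.range σ).Nonempty ∧
      ¬ ∃ γ : ℝ → UpperHalfPlane, (∀ s t : ℝ, dist (γ s) (γ t) = |s - t|) ∧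
        Set.range σ ⊆ Set.range γ ∧ h '' (Set.range σ) ⊆ Set.range γ := by
  obtain ⟨g, hg, hgne, z, ⟨_, ⟨u, rfl⟩, hu⟩, ⟨s, hs⟩⟩ := hself
  obtain ⟨t₀, hcl⟩ := hclose
  have hgu : g (α u) = α s := by rw [hu, hs]
  obtain ⟨i, hi, -⟩ := existsUnique_add_zsmul_mem_Ico hℓ s (t₀ + (L - ℓ) / 2)
  obtain ⟨j, hj, -⟩ := existsUnique_add_zsmul_mem_Ico hℓ u (t₀ + (L - ℓ) / 2)
  rw [zsmul_eq_mul] at hi hj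
  set s' := s + i * ℓ with hs'
  set u' := u + j * ℓ with hu'
  set h := a ^ i * g * (a ^ j)⁻¹ with hh
  have hhΓ : h ∈ Γ := Γ.mul_mem (Γ.mul_mem (Γ.zpow_mem ha i) hg) (Γ.inv_mem (Γ.zpow_mem ha j))
  have hcross : h (α u') = α s' := by
    rw [hh, IsometryEquiv.mul_apply, IsometryEquiv.mul_apply, hu', ← zpow_shift haα,
      IsometryEquiv.inv_apply_self, hgu, zpow_shift haα]
  have hne : h '' Set.range α ≠ Set.range α := by
    intro hcon
    apply hgne
    have e : g = a ^ (-i) * h * a ^ j := by rw [hh, zpow_neg]; group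
    have img : ∀ (f k : UpperHalfPlane ≃ᵢ UpperHalfPlane) (T : Set UpperHalfPlane),
        (f * k) '' T = f '' (k '' T) := by
      intro f k T
      rw [Set.image_image]; rfl
    rw [e, img, img, image_zpow haα, hcon, image_zpow haα]
  refine ⟨h, hhΓ, ?_, ?_⟩
  · intro h1
    apply hne
    rw [h1]
    ext z; simp
  set A : ℝ → UpperHalfPlane := fun t => α (s' + t) with hA
  set β : ℝ → UpperHalfPlane := fun t => h (α (u' + t)) with hβ
  have gA : IsGeod A := fun x y => by simp only [hA, hα]; congr 1; ring
  have gβ : IsGeod β := fun x y => by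
    simp only [hβ, h.isometry.dist_eq, hα]; congr 1; ring
  have h0 : A 0 = β 0 := by simp only [hA, hβ, add_zero, hcross]
  have rA : Set.range A = Set.range α := (Equiv.addLeft s').surjective.range_comp α
  have rβ : Set.range β = h '' Set.range α := by
    have : β = h ∘ (α ∘ (Equiv.addLeft u')) := rfl
    rw [this, Set.range_comp, (Equiv.addLeft u').surjective.range_comp α]
  obtain ⟨r, y, F⟩ := exists_fermi β gβ
  obtain ⟨f1, f2⟩ := far ε Γ hsys A β gA gβ h0 ℓ hℓ a (h * a * h⁻¹) ha
    (Γ.mul_mem (Γ.mul_mem hhΓ ha) (Γ.inv_mem hhΓ))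
    (fun t => by simp only [hA, haα, add_assoc])
    (fun t => by
      simp only [hβ, IsometryEquiv.mul_apply, IsometryEquiv.inv_apply_self, haα, add_assoc])
    (by rw [rA, rβ]; exact hne.symm) F
  have := crossing ε hε A β gA h0 ℓ hℓ F f1 f2 L (s' - t₀) (u' - t₀)
    (by linarith [hi.1]) (by linarith [hi.2]) (by linarith [hj.1]) (by linarith [hj.2])
    σ (fun t => h (σ t)) hσ (fun s t => by rw [h.isometry.dist_eq, hσ])
    (fun t => by
      simp only [hA]
      rw [show s' + ((t : ℝ) - (s' - t₀)) = t₀ + t by ring]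
      exact hcl t)
    (fun t => by
      simp only [hβ]
      rw [show u' + ((t : ℝ) - (u' - t₀)) = t₀ + t by ring, h.isometry.dist_eq]
      exact hcl t)
  rw [← Set.range_comp]
  exact this
end

section
/- (Morse Lemma in the hyperbolic plane.) For every K ≥ 1 and c ≥ 0 there exists C ≥ 0, depending only on K and c, with the following property: for all reals a ≤ b, every map f : ℝ → ℍ satisfying the quasigeodesic inequalities (1/K)·|s − t| − c ≤ dist(f(s), f(t)) ≤ K·|s − t| + c for all s, t ∈ [a, b], and every complete geodesic γ : ℝ → ℍ whose image contains both f(a) and f(b), one has dist(f(t), Set.range γ) ≤ C for every t ∈ [a, b]. -/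
open UpperHalfPlane

/-- Four point Gromov hyperbolicity of the upper half plane. -/
lemma morse_four_point (x y p q : UpperHalfPlane) :
    dist x q + dist y p ≤ max (dist x y + dist p q) (dist x p + dist y q) + 6 := by
  have hxy := dist_triangle y x p
  have t1 : dist x q ≤ dist x y + dist y p + dist p q :=
    (dist_triangle x p q).trans (by linarith [dist_triangle x y p])
  have t2 : dist y p ≤ dist x y + dist x q + dist p q := by
    have h1 := dist_triangle y x p
    have h2 := dist_triangle x q p
    rw [dist_comm y x] at h1
    rw [dist_comm q p] at h2
    linarith
  have hm1 := le_max_left (dist x y + dist p q) (dist x p + dist y q)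
  have hm2 := le_max_right (dist x y + dist p q) (dist x p + dist y q)
  set M := max (dist x y + dist p q) (dist x p + dist y q) with hM
  by_cases hu : dist x q < 2
  · linarith
  by_cases hv : dist y p < 2
  · linarith
  push Not at hu hv
  have pt := EuclideanGeometry.mul_dist_le_mul_dist_add_mul_dist (x : ℂ) (y : ℂ) (q : ℂ) (p : ℂ)
  have key : Real.sinh (dist x q / 2) * Real.sinh (dist y p / 2) ≤
      Real.sinh (dist x y / 2) * Real.sinh (dist p q / 2) +
      Real.sinh (dist x p / 2) * Real.sinh (dist y q / 2) := by
    simp only [UpperHalfPlane.sinh_half_dist]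
    have hx := x.im_pos
    have hy := y.im_pos
    have hp := p.im_pos
    have hq := q.im_pos
    simp only [Real.sqrt_mul hx.le, Real.sqrt_mul hy.le, Real.sqrt_mul hp.le]
    have sx := Real.sqrt_pos.2 hx
    have sy := Real.sqrt_pos.2 hy
    have sp := Real.sqrt_pos.2 hp
    have sq := Real.sqrt_pos.2 hq
    set X := √x.im
    set Y := √y.im
    set P := √p.im
    set Q := √q.im
    have hpos : 0 < 4 * (X * Y * P * Q) := by positivity
    have e1 : dist (x : ℂ) q / (2 * (X * Q)) * (dist (y : ℂ) p / (2 * (Y * P))) =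
        dist (x : ℂ) q * dist (y : ℂ) p / (4 * (X * Y * P * Q)) := by
      field_simp; ring
    have e2 : dist (x : ℂ) y / (2 * (X * Y)) * (dist (p : ℂ) q / (2 * (P * Q))) +
        dist (x : ℂ) p / (2 * (X * P)) * (dist (y : ℂ) q / (2 * (Y * Q))) =
        (dist (x : ℂ) y * dist (p : ℂ) q + dist (x : ℂ) p * dist (y : ℂ) q)
          / (4 * (X * Y * P * Q)) := by
      field_simp; ring
    rw [e1, e2]
    refine div_le_div_of_nonneg_right ?_ hpos.le
    rw [dist_comm (p : ℂ) q]
    linarith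
  have lower : ∀ u : ℝ, 2 ≤ u → Real.exp (u / 2) / 4 ≤ Real.sinh (u / 2) := by
    intro u hu
    rw [Real.sinh_eq]
    have h1 : Real.exp (-(u / 2)) ≤ 1 := Real.exp_le_one_iff.2 (by linarith)
    have h2 := Real.add_one_le_exp (u / 2)
    linarith
  have upper : ∀ u : ℝ, Real.sinh (u / 2) ≤ Real.exp (u / 2) / 2 := by
    intro u
    rw [Real.sinh_eq]
    have := Real.exp_pos (-(u / 2))
    linarith
  have snn : ∀ z w : UpperHalfPlane, 0 ≤ Real.sinh (dist z w / 2) := fun z w =>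
    Real.sinh_nonneg_iff.2 (by positivity)
  have l1 := mul_le_mul (lower _ hu) (lower _ hv) (by positivity) (snn _ _)
  have u1 := mul_le_mul (upper (dist x y)) (upper (dist p q)) (snn _ _) (by positivity)
  have u2 := mul_le_mul (upper (dist x p)) (upper (dist y q)) (snn _ _) (by positivity)
  have ee : ∀ u v : ℝ, Real.exp (u / 2) * Real.exp (v / 2) = Real.exp ((u + v) / 2) := by
    intro u v; rw [← Real.exp_add]; congr 1; ring
  have a1 := ee (dist x q) (dist y p)
  have a2 := ee (dist x y) (dist p q)
  have a3 := ee (dist x p) (dist y q)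
  have b2 : Real.exp ((dist x y + dist p q) / 2) ≤ Real.exp (M / 2) :=
    Real.exp_le_exp.2 (by linarith)
  have b3 : Real.exp ((dist x p + dist y q) / 2) ≤ Real.exp (M / 2) :=
    Real.exp_le_exp.2 (by linarith)
  have c1 : Real.exp ((dist x q + dist y p) / 2) ≤ 8 * Real.exp (M / 2) := by
    nlinarith
  have c2 : (8 : ℝ) ≤ Real.exp 3 := by
    have h1 := Real.add_one_le_exp (1 : ℝ)
    have h3 : Real.exp 3 = Real.exp 1 ^ 3 := by rw [← Real.exp_nat_mul]; norm_num
    rw [h3]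
    calc (8 : ℝ) = 2 ^ 3 := by norm_num
      _ ≤ _ := by gcongr; linarith
  have c3 : Real.exp ((dist x q + dist y p) / 2) ≤ Real.exp (3 + M / 2) := by
    rw [Real.exp_add]
    refine c1.trans ?_
    gcongr
  have := Real.exp_le_exp.1 c3
  linarith

/-- Going through an almost nearest point is almost optimal. -/
lemma morse_proj (γ : ℝ → UpperHalfPlane) (hγ : ∀ s t : ℝ, dist (γ s) (γ t) = |s - t|)
    (x : UpperHalfPlane) (s t : ℝ) (hs : ∀ u, dist x (γ s) ≤ dist x (γ u) + 1) :
    dist x (γ s) + |s - t| - 15 ≤ dist x (γ t) := by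
  by_cases hL : |s - t| < 8
  · linarith [hs t]
  push Not at hL
  obtain ⟨m, h1, h2⟩ : ∃ m, |s - m| = 8 ∧ |m - t| = |s - t| - 8 := by
    rcases le_total s t with h | h
    · rw [abs_of_nonpos (by linarith)] at hL
      refine ⟨s + 8, by norm_num, ?_⟩
      rw [abs_of_nonpos (by linarith), abs_of_nonpos (by linarith)]; ring
    · rw [abs_of_nonneg (by linarith)] at hL
      refine ⟨s - 8, by norm_num, ?_⟩
      rw [abs_of_nonneg (by linarith), abs_of_nonneg (by linarith)]; ring
  have h := morse_four_point x (γ s) (γ t) (γ m)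
  rw [dist_comm (γ t) (γ m), hγ, hγ, hγ, h1, h2] at h
  have := hs m
  rcases max_choice (dist x (γ s) + (|s - t| - 8)) (dist x (γ t) + 8) with h' | h' <;>
    rw [h'] at h <;> linarith

/-- Contraction of the projection. -/
lemma morse_contract (γ : ℝ → UpperHalfPlane) (hγ : ∀ s t : ℝ, dist (γ s) (γ t) = |s - t|)
    (x y : UpperHalfPlane) (s t : ℝ) (hs : ∀ u, dist x (γ s) ≤ dist x (γ u) + 1)
    (ht : ∀ u, dist y (γ t) ≤ dist y (γ u) + 1) (hxy : dist x y ≤ dist x (γ s)) :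
    |s - t| ≤ 36 := by
  have h1 := morse_proj γ hγ x s t hs
  have h2 := morse_proj γ hγ y t s ht
  have h := morse_four_point x y (γ s) (γ t)
  rw [hγ] at h
  rw [abs_sub_comm t s] at h2
  have : 0 ≤ dist y (γ t) := dist_nonneg
  rcases max_choice (dist x y + |s - t|) (dist x (γ s) + dist y (γ t)) with h' | h' <;>
    rw [h'] at h <;> linarith

lemma morse_walk (γ : ℝ → UpperHalfPlane) (hγ : ∀ s t : ℝ, dist (γ s) (γ t) = |s - t|)
    (π : UpperHalfPlane → ℝ) (r : UpperHalfPlane → ℝ)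
    (hπ : ∀ x, dist x (γ (π x)) ≤ r x + 1) (hr : ∀ x u, r x ≤ dist x (γ u))
    (D : ℝ) (g : ℕ → UpperHalfPlane) (hg : ∀ i, dist (g i) (g (i + 1)) ≤ D)
    (hex : ∃ k, r (g k) ≤ D) :
    ∃ n : ℕ, r (g n) ≤ D ∧ (∀ i < n, D < r (g i)) ∧ |π (g 0) - π (g n)| ≤ 36 * n ∧
      dist (g 0) (g n) ≤ n * D := by
  classical
  have hmin : ∀ i < Nat.find hex, D < r (g i) := fun i hi => not_le.1 (Nat.find_min hex hi)
  refine ⟨Nat.find hex, Nat.find_spec hex, hmin, ?_⟩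
  have main : ∀ n ≤ Nat.find hex, |π (g 0) - π (g n)| ≤ 36 * n ∧ dist (g 0) (g n) ≤ n * D := by
    intro n
    induction n with
    | zero => intro _; simp
    | succ k ih =>
      intro hk
      obtain ⟨i1, i2⟩ := ih (by omega)
      have h1 := morse_contract γ hγ (g k) (g (k + 1)) (π (g k)) (π (g (k + 1)))
        (fun u => by linarith [hπ (g k), hr (g k) u])
        (fun u => by linarith [hπ (g (k + 1)), hr (g (k + 1)) u])
        (by linarith [hg k, hmin k (by omega), hr (g k) (π (g k))])
      have h2 := abs_sub_le (π (g 0)) (π (g k)) (π (g (k + 1)))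
      have h3 := dist_triangle (g 0) (g k) (g (k + 1))
      push_cast
      constructor
      · linarith
      · linarith [hg k]
  exact main _ le_rfl

theorem morse_lemma_hyperbolic_plane
    (K : ℝ) (hK : 1 ≤ K) (c : ℝ) (hc : 0 ≤ c) :
    ∃ C : ℝ, 0 ≤ C ∧
      ∀ (a b : ℝ), a ≤ b →
        ∀ f : ℝ → UpperHalfPlane,
          (∀ s ∈ Set.Icc a b, ∀ t ∈ Set.Icc a b,
            (1 / K) * |s - t| - c ≤ dist (f s) (f t) ∧
              dist (f s) (f t) ≤ K * |s - t| + c) →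
          ∀ γ : ℝ → UpperHalfPlane,
            (∀ s t : ℝ, dist (γ s) (γ t) = |s - t|) →
            f a ∈ Set.range γ → f b ∈ Set.range γ →
            ∀ t ∈ Set.Icc a b, Metric.infDist (f t) (Set.range γ) ≤ C := by
  have hK0 : 0 < K := by linarith
  obtain ⟨D, hD⟩ : ∃ D, D = K * (72 * K) + c := ⟨_, rfl⟩
  have hD0 : 0 ≤ D := by rw [hD]; positivity
  refine ⟨(2 * D + c + 146) * D + D, by positivity, ?_⟩
  intro a b hab f hf γ hγ hfa hfb t ht
  have hne : (Set.range γ).Nonempty := ⟨_, hfa⟩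
  have hex : ∀ x, ∃ s, dist x (γ s) ≤ Metric.infDist x (Set.range γ) + 1 := by
    intro x
    obtain ⟨y, ⟨s, rfl⟩, hs⟩ := (Metric.infDist_lt_iff hne).1
      (lt_add_one (Metric.infDist x (Set.range γ)))
    exact ⟨s, hs.le⟩
  choose π hπ using hex
  have hr : ∀ x u, Metric.infDist x (Set.range γ) ≤ dist x (γ u) := fun x u =>
    Metric.infDist_le_dist_of_mem ⟨u, rfl⟩
  have ra : Metric.infDist (f a) (Set.range γ) ≤ D := by
    rw [Metric.infDist_zero_of_mem hfa]; exact hD0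
  have rb : Metric.infDist (f b) (Set.range γ) ≤ D := by
    rw [Metric.infDist_zero_of_mem hfb]; exact hD0
  obtain ⟨ht1, ht2⟩ := ht
  have hstep : ∀ u ∈ Set.Icc a b, ∀ v ∈ Set.Icc a b, |u - v| ≤ 72 * K → dist (f u) (f v) ≤ D := by
    intro u hu v hv huv
    rw [hD]
    refine (hf u hu v hv).2.trans ?_
    gcongr
  have hi0 : ∀ i : ℕ, 0 ≤ (i : ℝ) * (72 * K) := fun i => by positivity
  -- right walk
  have memR : ∀ i : ℕ, min (t + i * (72 * K)) b ∈ Set.Icc a b := fun i =>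
    ⟨le_min (by linarith [hi0 i]) hab, min_le_right _ _⟩
  have memL : ∀ i : ℕ, max (t - i * (72 * K)) a ∈ Set.Icc a b := fun i =>
    ⟨le_max_right _ _, max_le (by linarith [hi0 i]) hab⟩
  obtain ⟨k, hk⟩ : ∃ k : ℕ, b - a ≤ k * (72 * K) := by
    obtain ⟨k, hk⟩ := exists_nat_ge ((b - a) / (72 * K))
    exact ⟨k, (div_le_iff₀ (by positivity)).1 hk⟩
  obtain ⟨n, n1, n2, n3, n4⟩ := morse_walk γ hγ π (fun x => Metric.infDist x (Set.range γ)) hπ hr D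
    (fun i => f (min (t + i * (72 * K)) b))
    (fun i => hstep _ (memR i) _ (memR (i + 1)) (by
      refine (abs_min_sub_min_le_max _ _ _ _).trans ?_
      push_cast
      refine max_le ?_ ?_
      · rw [abs_sub_comm, abs_of_nonneg] <;> linarith
      · simp; positivity))
    ⟨k, by
      show Metric.infDist (f (min (t + k * (72 * K)) b)) _ ≤ D
      rw [min_eq_right (by linarith)]; exact rb⟩
  obtain ⟨m, m1, m2, m3, m4⟩ := morse_walk γ hγ π (fun x => Metric.infDist x (Set.range γ)) hπ hr D
    (fun i => f (max (t - i * (72 * K)) a))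
    (fun i => hstep _ (memL i) _ (memL (i + 1)) (by
      refine (abs_max_sub_max_le_max _ _ _ _).trans ?_
      push_cast
      refine max_le ?_ ?_
      · rw [abs_of_nonneg] <;> linarith
      · simp; positivity))
    ⟨k, by
      show Metric.infDist (f (max (t - k * (72 * K)) a)) _ ≤ D
      rw [max_eq_right (by linarith)]; exact ra⟩
  have z1 : min (t + ((0 : ℕ) : ℝ) * (72 * K)) b = t := by simp [ht2]
  have z2 : max (t - ((0 : ℕ) : ℝ) * (72 * K)) a = t := by simp [ht1]
  simp only [z1] at n3 n4
  simp only [z2] at m3 m4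
  have hR : t + (n - 1) * (72 * K) ≤ min (t + n * (72 * K)) b := by
    refine le_min (by nlinarith) ?_
    rcases n with _ | j
    · push_cast; linarith
    · by_contra hlt
      push_cast at hlt
      have := n2 j (by omega)
      rw [min_eq_right (by linarith)] at this
      linarith
  have hL : max (t - m * (72 * K)) a ≤ t - (m - 1) * (72 * K) := by
    refine max_le (by nlinarith) ?_
    rcases m with _ | j
    · push_cast; linarith
    · by_contra hlt
      push_cast at hlt
      have := m2 j (by omega)
      rw [max_eq_right (by linarith)] at this
      linarith
  have hlow := (hf _ (memR n) _ (memL m)).1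
  generalize min (t + n * (72 * K)) b = u at *
  generalize max (t - m * (72 * K)) a = v at *
  have hup : dist (f u) (f v) ≤ 2 * (D + 1) + 36 * (n + m) := by
    have h1 := dist_triangle4 (f u) (γ (π (f u))) (γ (π (f v))) (f v)
    rw [hγ, dist_comm (γ (π (f v))) (f v)] at h1
    have h2 := abs_sub_le (π (f u)) (π (f t)) (π (f v))
    rw [abs_sub_comm (π (f u)) (π (f t))] at h2
    linarith [hπ (f u), hπ (f v)]
  have hlow2 : ((n : ℝ) + m - 2) * 72 ≤ (1 / K) * |u - v| := by
    have : ((n : ℝ) + m - 2) * 72 * K ≤ |u - v| := by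
      have := le_abs_self (u - v)
      linarith
    rw [one_div, ← div_eq_inv_mul, le_div_iff₀ hK0]
    exact this
  have hn : (n : ℝ) ≤ 2 * D + c + 146 := by
    have : (0 : ℝ) ≤ n := by positivity
    have : (0 : ℝ) ≤ m := by positivity
    linarith
  have h1 := Metric.infDist_le_infDist_add_dist (s := Set.range γ) (x := f t) (y := f u)
  have h2 : n * D ≤ (2 * D + c + 146) * D := mul_le_mul_of_nonneg_right hn hD0
  linarith
end
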